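/- arXiv:2412.06585 — 7 statements merged into one kernel-verified Lean document; each statement's English description precedes it below -/
import Mathlib

section
/- Let k be an algebraically closed field of characteristic 0 and let q be a finite-dimensional Lie algebra over k with ind q = 1 (i.e. dim q_β ≥ 1 for every β ∈ q* and dim q_β = 1 for some β). Suppose q is not contact, i.e. every β ∈ q* with dim q_β = 1 satisfies β(q_β) = 0. Then for every α ∈ q* with dim q_α = 1 and every y ∈ q_α, the element y lies in the subspace ⁅q,y⁆ = {⁅x,y⁆ : x ∈ q}; in particular q_α ⊆ ⁅q, q_α⁆. -/
open Module

/-- The coadjoint stabiliser `q_α = {ξ ∈ q : α(⁅ξ,y⁆) = 0 for all y}` of a linear form `α`. -/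
def coadjointStabilizer (k : Type*) {q : Type*} [Field k] [LieRing q] [LieAlgebra k q]
    (α : Module.Dual k q) : Submodule k q where
  carrier := {ξ | ∀ y : q, α ⁅ξ, y⁆ = 0}
  add_mem' := fun ha hb y => by rw [add_lie, map_add, ha y, hb y, add_zero]
  zero_mem' := fun y => by rw [zero_lie, map_zero]
  smul_mem' := fun c x hx y => by rw [smul_lie, map_smul, hx y, smul_zero]

/-- If `C` vanishes on `ker A`, then some nonzero multiple `t • C` can be added to `A` without
enlarging the kernel. -/
lemma exists_ne_zero_ker_add_smul_le {k V W : Type*} [Field k] [Infinite k]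
    [AddCommGroup V] [Module k V] [FiniteDimensional k V] [AddCommGroup W] [Module k W]
    (A C : V →ₗ[k] W) (h : LinearMap.ker A ≤ LinearMap.ker C) :
    ∃ t : k, t ≠ 0 ∧ LinearMap.ker (A + t • C) ≤ LinearMap.ker A := by
  obtain ⟨R, hR⟩ := A.rangeRestrict.exists_rightInverse_of_surjective A.range_rangeRestrict
  obtain ⟨L, hL⟩ := R.exists_extend
  have hA (x : V) : A (L (A x)) = A x := by
    have h1 : L (A x) = R (A.rangeRestrict x) := LinearMap.congr_fun hL (A.rangeRestrict x)
    have h2 := congrArg Subtype.val (LinearMap.congr_fun hR (A.rangeRestrict x))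
    rw [h1]
    exact h2
  have hC (x : V) : C (L (A x)) = C x := by
    have : L (A x) - x ∈ LinearMap.ker A := by simp [hA]
    have := h this
    rwa [LinearMap.mem_ker, map_sub, sub_eq_zero] at this
  let N : Module.End k V := L ∘ₗ C
  obtain ⟨μ, hμ⟩ := (N.finite_hasEigenvalue.union (Set.finite_singleton (0 : k))).infinite_compl.nonempty
  simp only [Set.mem_compl_iff, Set.mem_union, Set.mem_singleton_iff, not_or] at hμ
  refine ⟨-μ⁻¹, by simpa using hμ.2, fun x hx => ?_⟩
  have hx' : A x = μ⁻¹ • C x := by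
    simpa [add_neg_eq_zero] using hx
  have hN : N (L (A x)) = μ • L (A x) := by
    change L (C (L (A x))) = _
    rw [hC, hx', map_smul, smul_inv_smul₀ hμ.2]
  have h0 : L (A x) = 0 := by
    by_contra hne
    exact hμ.1 (Module.End.hasEigenvalue_of_hasEigenvector
      (Module.End.hasEigenvector_iff.mpr ⟨Module.End.mem_eigenspace_iff.mpr hN, hne⟩))
  rw [LinearMap.mem_ker, ← hA, h0, map_zero]

/-- if `ind q = 1` and `q` is not contact, then for every regular `α`
and every `y ∈ q_α` we have `y ∈ ⁅q, y⁆`. -/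
theorem stmt0 (k q : Type*) [Field k] [IsAlgClosed k] [CharZero k]
    [LieRing q] [LieAlgebra k q] [FiniteDimensional k q]
    (hind1 : ∀ β : Module.Dual k q, 1 ≤ Module.finrank k ↥(coadjointStabilizer k β))
    (hind2 : ∃ β : Module.Dual k q, Module.finrank k ↥(coadjointStabilizer k β) = 1)
    (hnc : ∀ β : Module.Dual k q, Module.finrank k ↥(coadjointStabilizer k β) = 1 →
      ∀ ξ ∈ coadjointStabilizer k β, β ξ = 0) :
    ∀ α : Module.Dual k q, Module.finrank k ↥(coadjointStabilizer k α) = 1 →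
      ∀ y ∈ coadjointStabilizer k α, ∃ x : q, ⁅x, y⁆ = y := by
  intro α hα y hy
  by_contra hne
  let ady : q →ₗ[k] q := (LieAlgebra.ad k q y : Module.End k q)
  have hy' : y ∉ LinearMap.range ady := by
    rintro ⟨x, hx⟩
    exact hne ⟨-x, by rw [neg_lie, lie_skew]; exact hx⟩
  obtain ⟨γ, hγy, hγ⟩ := Submodule.exists_le_ker_of_notMem hy'
  have hγl (z : q) : γ ⁅y, z⁆ = 0 := hγ ⟨z, rfl⟩
  have hy0 : y ≠ 0 := by
    rintro rfl
    simp at hγy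
  have hspan : ∀ x ∈ coadjointStabilizer k α, ∃ c : k, c • y = x := by
    intro x hx
    obtain ⟨c, hc⟩ := (finrank_eq_one_iff_of_nonzero' (⟨y, hy⟩ : coadjointStabilizer k α)
      (by simpa using hy0)).mp hα ⟨x, hx⟩
    exact ⟨c, congrArg Subtype.val hc⟩
  let B (β : Module.Dual k q) : q →ₗ[k] Module.Dual k q :=
    (LieAlgebra.ad k q : q →ₗ[k] Module.End k q).compr₂ β
  have hB (β : Module.Dual k q) (x : q) : x ∈ LinearMap.ker (B β) ↔ x ∈ coadjointStabilizer k β :=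
    LinearMap.ext_iff
  obtain ⟨t, ht, hker⟩ := exists_ne_zero_ker_add_smul_le (B α) (B γ) (by
    intro x hx
    obtain ⟨c, rfl⟩ := hspan x ((hB α x).mp hx)
    exact (hB γ _).mpr (Submodule.smul_mem _ c hγl))
  have hadd : B (α + t • γ) = B α + t • B γ := rfl
  have hyt : y ∈ coadjointStabilizer k (α + t • γ) := fun z => by
    simp [hγl z, hy z]
  have hdim : Module.finrank k (coadjointStabilizer k (α + t • γ)) = 1 := by
    refine (finrank_eq_one_iff_of_nonzero' ⟨y, hyt⟩ (by simpa using hy0)).mpr fun x => ?_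
    obtain ⟨c, hc⟩ := hspan x ((hB α x).mp (hker (hadd ▸ (hB _ _).mpr x.2)))
    exact ⟨c, Subtype.ext hc⟩
  have h1 := hnc _ hdim y hyt
  rw [LinearMap.add_apply, hnc α hα y hy, zero_add, LinearMap.smul_apply, smul_eq_mul] at h1
  exact (mul_ne_zero ht hγy) h1
end

section
/- Let q be a finite-dimensional Lie algebra over an algebraically closed field k of characteristic 0 with ind q = 1. Then q is contact if and only if there exists α ∈ q* with dim q_α = 1 such that α is not in the image of the coadjoint action at α, i.e. there is no ξ ∈ q with α(y) = -α(⁅ξ,y⁆) for all y ∈ q. -/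
open Module

/-- `q` is contact: some `α` with one-dimensional stabiliser `q_α` has `α(q_α) ≠ 0`. -/
def IsContact (k q : Type*) [Field k] [LieRing q] [LieAlgebra k q] : Prop :=
  ∃ α : Module.Dual k q, Module.finrank k ↥(coadjointStabilizer k α) = 1 ∧
    ∃ ξ ∈ coadjointStabilizer k α, α ξ ≠ 0

/-- `ind q = 1`: every coadjoint stabiliser has dimension ≥ 1 and some has dimension 1. -/
def HasIndexOne (k q : Type*) [Field k] [LieRing q] [LieAlgebra k q] : Prop :=
  (∀ β : Module.Dual k q, 1 ≤ Module.finrank k ↥(coadjointStabilizer k β)) ∧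
  (∃ β : Module.Dual k q, Module.finrank k ↥(coadjointStabilizer k β) = 1)

/-- The linear form `α` lies in the image of the coadjoint action at `α` exactly when it vanishes on
its coadjoint stabiliser. -/
theorem exists_eq_neg_apply_lie_iff {k q : Type*} [Field k] [LieRing q] [LieAlgebra k q]
    [FiniteDimensional k q] (α : Module.Dual k q) :
    (∃ ξ : q, ∀ y : q, α y = -α ⁅ξ, y⁆) ↔ ∀ ξ ∈ coadjointStabilizer k α, α ξ = 0 := by
  let B : q →ₗ[k] Module.Dual k q := (LieModule.toEnd k q q : q →ₗ[k] Module.End k q).compr₂ α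
  have hB (x y : q) : B x y = α ⁅x, y⁆ := rfl
  have hker (ξ : q) : ξ ∈ LinearMap.ker B ↔ ξ ∈ coadjointStabilizer k α := LinearMap.ext_iff
  calc (∃ ξ : q, ∀ y : q, α y = -α ⁅ξ, y⁆)
      ↔ α ∈ LinearMap.range B.flip := exists_congr fun ξ => by
        simp only [LinearMap.ext_iff, LinearMap.flip_apply, hB, ← map_neg, lie_skew, eq_comm]
    _ ↔ ∀ ξ ∈ coadjointStabilizer k α, α ξ = 0 := by
        simp only [← LinearMap.dualAnnihilator_ker_eq_range_flip, Submodule.mem_dualAnnihilator,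
          hker]

/-- a Lie algebra of index 1 is contact iff for some `α` with
one-dimensional stabiliser, `α` is not in the image of the coadjoint action at `α`. -/
theorem stmt1 (k q : Type*) [Field k] [IsAlgClosed k] [CharZero k]
    [LieRing q] [LieAlgebra k q] [FiniteDimensional k q]
    (hind : HasIndexOne k q) :
    IsContact k q ↔
      ∃ α : Module.Dual k q, Module.finrank k ↥(coadjointStabilizer k α) = 1 ∧
        ¬ ∃ ξ : q, ∀ y : q, α y = -α ⁅ξ, y⁆ := by
  simp only [IsContact, exists_eq_neg_apply_lie_iff, not_forall, exists_prop, ne_eq]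
end

section
/- Let q be a finite-dimensional Lie algebra over an algebraically closed field k of characteristic 0, V ⊆ q an abelian Lie ideal, l ⊆ q a Lie subalgebra with q = l ⊕ V as k-vector spaces. Let γ ∈ V* be such that the linear map l → V*, x ↦ x·γ, is surjective (the orbit Lγ is open), and assume ind q = 1. If the Lie algebra l_γ is not contact, then q is contact if and only if ind l_{<γ>} = 0, i.e. if and only if there exists β ∈ (l_{<γ>})* whose coadjoint stabiliser in l_{<γ>} is zero. -/
open Module

section Semidirect

variable (k : Type*) {q : Type*} [Field k] [LieRing q] [LieAlgebra k q]

/-- The stabiliser `l_γ = {x ∈ l : x·γ = 0}` of `γ ∈ V*`, where `(x·γ)(v) = -γ(⁅x,v⁆)`. -/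
def lGamma (V : LieIdeal k q) (l : LieSubalgebra k q) (γ : Module.Dual k ↥V) :
    LieSubalgebra k q where
  carrier := {x | x ∈ l ∧ ∀ v : ↥V, γ ⁅x, v⁆ = 0}
  zero_mem' := ⟨l.zero_mem, fun v => by rw [zero_lie, map_zero]⟩
  add_mem' := fun {x y} hx hy => ⟨l.add_mem hx.1 hy.1, fun v => by
    rw [add_lie, map_add, hx.2 v, hy.2 v, add_zero]⟩
  smul_mem' := fun c x hx => ⟨l.smul_mem c hx.1, fun v => by
    rw [smul_lie, map_smul, hx.2 v, smul_zero]⟩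
  lie_mem' := fun {x y} hx hy => ⟨l.lie_mem hx.1 hy.1, fun v => by
    rw [lie_lie, map_sub, hx.2 ⁅y, v⁆, hy.2 ⁅x, v⁆, sub_zero]⟩

/-- The normaliser `l_{<γ>} = {x ∈ l : x·γ ∈ k·γ}` of the line `k·γ`. -/
def lNorm (V : LieIdeal k q) (l : LieSubalgebra k q) (γ : Module.Dual k ↥V) :
    LieSubalgebra k q where
  carrier := {x | x ∈ l ∧ ∃ c : k, ∀ v : ↥V, γ ⁅x, v⁆ = c * γ v}
  zero_mem' := ⟨l.zero_mem, 0, fun v => by rw [zero_lie, map_zero, zero_mul]⟩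
  add_mem' := fun {x y} hx hy => ⟨l.add_mem hx.1 hy.1,
    hx.2.choose + hy.2.choose, fun v => by
      rw [add_lie, map_add, hx.2.choose_spec v, hy.2.choose_spec v, add_mul]⟩
  smul_mem' := fun c x hx => ⟨l.smul_mem c hx.1, c * hx.2.choose, fun v => by
    rw [smul_lie, map_smul, hx.2.choose_spec v, smul_eq_mul, mul_assoc]⟩
  lie_mem' := fun {x y} hx hy => ⟨l.lie_mem hx.1 hy.1, 0, fun v => by
    rw [lie_lie, map_sub, hx.2.choose_spec ⁅y, v⁆, hy.2.choose_spec ⁅x, v⁆,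
      hy.2.choose_spec v, hx.2.choose_spec v, zero_mul]
    ring⟩

end Semidirect

section Derivation

open DualNumber in
/-- The ring homomorphism `a ↦ a + ε D a` into the dual numbers attached to a derivation `D`. -/
def Derivation.toDualNumberHom {k S : Type*} [CommRing k] [CommRing S] [Algebra k S]
    (D : Derivation k S S) : S →+* S[ε] where
  toFun a := TrivSqZeroExt.inl a + TrivSqZeroExt.inr (D a)
  map_one' := by ext <;> simp
  map_mul' a b := by ext <;> simp [mul_comm]
  map_zero' := by ext <;> simp
  map_add' a b := by ext <;> simp

/-- If a derivation acts on the entries of `M` by `M ↦ Bᵀ M + M B`, then `det M` divides its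
derivative. -/
theorem Derivation.det_dvd_apply_det {k S n : Type*} [CommRing k] [CommRing S] [Algebra k S]
    [Fintype n] [DecidableEq n] (D : Derivation k S S) (M B : Matrix n n S)
    (h : M.map D = B.transpose * M + M * B) : M.det ∣ D M.det := by
  set P : Matrix n n (DualNumber S) := 1 + Matrix.of fun i j => TrivSqZeroExt.inr (B i j) with hP
  have key : M.map D.toDualNumberHom = P.transpose * M.map TrivSqZeroExt.inl * P := by
    have hM : ∀ i j, D (M i j) = ∑ x, B x i * M x j + ∑ x, M i x * B x j := fun i j => by
      simpa [Matrix.mul_apply] using congrFun (congrFun h i) j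
    ext i j
    · simp [toDualNumberHom, hP, Matrix.mul_apply, Matrix.one_apply, add_mul, mul_add,
        Finset.sum_add_distrib, TrivSqZeroExt.fst_sum, eq_comm]
    · simp [toDualNumberHom, hP, Matrix.mul_apply, Matrix.one_apply, add_mul, mul_add,
        Finset.sum_add_distrib, TrivSqZeroExt.fst_sum, TrivSqZeroExt.snd_sum, hM,
        mul_comm, add_comm]
  have hdet := congrArg (fun z => TrivSqZeroExt.snd z) (congrArg Matrix.det key)
  rw [Matrix.det_mul, Matrix.det_mul, Matrix.det_transpose] at hdet
  have h1 : (M.map D.toDualNumberHom).det = D.toDualNumberHom M.det :=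
    (RingHom.map_det _ _).symm
  have h2 : (M.map (TrivSqZeroExt.inl : S → DualNumber S)).det = TrivSqZeroExt.inl M.det :=
    (RingHom.map_det (TrivSqZeroExt.inlHom S S) M).symm
  rw [h1, h2, mul_right_comm] at hdet
  refine ⟨(P.det * P.det).snd, ?_⟩
  simpa [toDualNumberHom, mul_comm] using hdet

/-- In characteristic zero, a prime `t` not dividing `D t` divides no nonzero `f` with
`f ∣ D f`. -/
theorem Derivation.eq_zero_of_prime_dvd {k S : Type*} [Field k] [CharZero k] [CommRing S]
    [IsDomain S] [WfDvdMonoid S] [Algebra k S] (D : Derivation k S S) {t f : S} (ht : Prime t)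
    (hDt : ¬ t ∣ D t) (hf : f ∣ D f) (htf : t ∣ f) : f = 0 := by
  by_contra hf0
  obtain ⟨g, hg, hgt⟩ :=
    (FiniteMultiplicity.of_not_isUnit ht.not_isUnit hf0).exists_eq_pow_mul_and_not_dvd
  generalize multiplicity t f = m at hg
  obtain ⟨c, hc⟩ := hf
  cases m with
  | zero => exact hgt (by simpa [hg] using htf)
  | succ m =>
    rw [hg, D.leibniz, D.leibniz_pow] at hc
    simp only [smul_eq_mul, nsmul_eq_mul, Nat.add_sub_cancel] at hc
    have h0 : t ^ m * (((m + 1 : ℕ) : S) * (g * D t)) = t ^ m * (t * (g * c - D g)) := by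
      linear_combination hc
    have h1 : t ∣ ((m + 1 : ℕ) : S) * (g * D t) :=
      ⟨_, mul_left_cancel₀ (pow_ne_zero _ ht.ne_zero) h0⟩
    have hu : IsUnit ((m + 1 : ℕ) : S) := by
      have : IsUnit ((m + 1 : ℕ) : k) := (Nat.cast_ne_zero.2 m.succ_ne_zero).isUnit
      simpa using this.map (algebraMap k S)
    rcases ht.dvd_or_dvd ((hu.dvd_mul_left).1 h1) with h | h
    exacts [hgt h, hDt h]

/-- A polynomial vanishing at all points with vanishing `i`-th coordinate is divisible by `X i`. -/
theorem MvPolynomial.X_dvd_of_eval_eq_zero {k σ : Type*} [Field k] [Infinite k] [DecidableEq σ]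
    {f : MvPolynomial σ k} (i : σ) (h : ∀ s : σ → k, s i = 0 → eval s f = 0) :
    (X i : MvPolynomial σ k) ∣ f := by
  have h0 : bind₁ (fun j => if j = i then 0 else X j) f = 0 := by
    refine MvPolynomial.funext fun s => ?_
    rw [map_zero, ← h (fun j => if j = i then 0 else s j) (if_pos rfl)]
    change eval₂Hom (RingHom.id k) s _ = _
    rw [eval₂Hom_bind₁]
    simp only [eval, apply_ite (eval₂Hom (RingHom.id k) s), map_zero, eval₂Hom_X']
  rw [← Ideal.mem_span_singleton, ← Ideal.Quotient.eq_zero_iff_mem]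
  have hmk : (Ideal.Quotient.mkₐ k (Ideal.span {(X i : MvPolynomial σ k)})).comp
      (bind₁ fun j => if j = i then 0 else X j) = Ideal.Quotient.mkₐ k _ := by
    refine algHom_ext fun j => ?_
    by_cases hj : j = i
    · simp [hj]
    · simp [hj]
  simpa [h0] using (AlgHom.congr_fun hmk f).symm

end Derivation

section Contact

variable {k q A η : Type*} [Field k] [LieRing q] [LieAlgebra k q] [CommRing A] [Algebra k A]

/-- The Gram matrix of the alternating form
`((s, x), (t, y)) ↦ s α(y) - t α(x) + α(⁅x, y⁆)` on `k ⊕ q`, for an `A`-valued linear form `α`. -/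
noncomputable def contactMatrix (e : Basis η k q) (α : q →ₗ[k] A) : Matrix (Unit ⊕ η) (Unit ⊕ η) A :=
  Matrix.fromBlocks 0 (Matrix.of fun _ j => α (e j)) (Matrix.of fun i _ => -α (e i))
    (Matrix.of fun i j => α ⁅e i, e j⁆)

theorem contactMatrix_map {B : Type*} [CommRing B] [Algebra k B] (e : Basis η k q)
    (α : q →ₗ[k] A) (φ : A →ₐ[k] B) :
    (contactMatrix e α).map φ = contactMatrix e (φ.toLinearMap ∘ₗ α) := by
  ext (i | i) (j | j) <;> simp [contactMatrix]

variable [Fintype η]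

theorem sum_algebraMap_repr_mul (e : Basis η k q) (ψ : q →ₗ[k] A) (y : q) :
    ∑ c, algebraMap k A (e.repr y c) * ψ (e c) = ψ y := by
  conv_rhs => rw [← e.sum_repr y, map_sum]
  simp_rw [map_smul, Algebra.smul_def]

theorem contactMatrix_mulVec_inr (e : Basis η k q) (α : Dual k q) (s : k) (x : q) (i : η) :
    (contactMatrix e α).mulVec (Sum.elim (fun _ => s) (e.repr x)) (Sum.inr i) =
      -(s * α (e i)) + α ⁅e i, x⁆ := by
  simpa [contactMatrix, Matrix.mulVec, dotProduct, mul_comm] using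
    sum_algebraMap_repr_mul e (α ∘ₗ (LieAlgebra.ad k q (e i) : q →ₗ[k] q)) x

theorem contactMatrix_mulVec_inl (e : Basis η k q) (α : Dual k q) (s : k) (x : q) (i : Unit) :
    (contactMatrix e α).mulVec (Sum.elim (fun _ => s) (e.repr x)) (Sum.inl i) = α x := by
  simpa [contactMatrix, Matrix.mulVec, dotProduct, mul_comm] using
    sum_algebraMap_repr_mul e α x

variable [DecidableEq η]

theorem det_contactMatrix_ne_zero (e : Basis η k q) (α : Dual k q)
    (h : finrank k (coadjointStabilizer k α) = 1)
    (hα : ∃ ξ ∈ coadjointStabilizer k α, α ξ ≠ 0) : (contactMatrix e α).det ≠ 0 := by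
  intro hdet
  obtain ⟨w, hw0, hw⟩ := Matrix.exists_mulVec_eq_zero_iff.2 hdet
  obtain ⟨ξ, hξ, hαξ⟩ := hα
  obtain ⟨s, x, rfl⟩ : ∃ s x, w = Sum.elim (fun _ => s) (e.repr x) :=
    ⟨w (Sum.inl ()), ∑ i, w (Sum.inr i) • e i, by
      ext (i | i)
      · rfl
      · rw [Sum.elim_inr, e.repr_sum_self]⟩
  have hx : α x = 0 := by
    rw [← contactMatrix_mulVec_inl e α s x (), hw]; rfl
  have hy : ∀ y, s * α y = α ⁅y, x⁆ := by
    have : s • α = -(α ∘ₗ (LieAlgebra.ad k q x : q →ₗ[k] q)) := by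
      refine e.ext fun i => ?_
      have := congrFun hw (Sum.inr i)
      rw [contactMatrix_mulVec_inr] at this
      simpa using (neg_add_eq_zero.1 this).trans (by rw [← lie_skew, map_neg])
    intro y
    rw [← lie_skew, map_neg]
    exact LinearMap.congr_fun this y
  have hs : s = 0 := by
    have := hy ξ
    rw [hξ x] at this
    exact (mul_eq_zero.1 this).resolve_right hαξ
  subst hs
  have hxs : x ∈ coadjointStabilizer k α := fun y => by
    rw [← lie_skew, map_neg, ← hy, zero_mul, neg_zero]
  obtain ⟨c, hc⟩ := (finrank_eq_one_iff_of_nonzero' (⟨ξ, hξ⟩ : coadjointStabilizer k α)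
    (fun h0 => hαξ (by rw [show ξ = 0 from congrArg Subtype.val h0, map_zero]))).1 h ⟨x, hxs⟩
  have hcx : c • ξ = x := congrArg Subtype.val hc
  have : x = 0 := by
    rw [← hcx, map_smul, smul_eq_mul] at hx
    rw [← hcx, (mul_eq_zero.1 hx).resolve_right hαξ, zero_smul]
  subst this
  exact hw0 (by ext (i | i) <;> simp)

theorem eq_zero_of_det_contactMatrix_ne_zero (e : Basis η k q) (α : Dual k q)
    (h : (contactMatrix e α).det ≠ 0) {ξ : q} (hξ : ξ ∈ coadjointStabilizer k α)
    (hαξ : α ξ = 0) : ξ = 0 := by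
  by_contra h0
  refine h (Matrix.exists_mulVec_eq_zero_iff.1
    ⟨Sum.elim (fun _ => 0) (e.repr ξ), fun hw => h0 ?_, ?_⟩)
  · refine e.ext_elem fun i => ?_
    simpa using congrFun hw (Sum.inr i)
  · ext (i | i)
    · rw [contactMatrix_mulVec_inl, hαξ]; rfl
    · rw [contactMatrix_mulVec_inr, ← lie_skew, map_neg, hξ]; simp

/-- A derivation of `A` acting on the values of `α` through `∑ p i • ad (x i)` acts on
`contactMatrix e α` by congruence. -/
theorem det_contactMatrix_dvd {κ : Type*} [Fintype κ] (e : Basis η k q) (α : q →ₗ[k] A)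
    (D : Derivation k A A) (p : κ → A) (x : κ → q)
    (h : ∀ y, D (α y) = ∑ i, p i * α ⁅x i, y⁆) :
    (contactMatrix e α).det ∣ D (contactMatrix e α).det := by
  refine D.det_dvd_apply_det _ (Matrix.fromBlocks 0 0 0
    (Matrix.of fun c b => ∑ i, p i * algebraMap k A (e.repr ⁅x i, e b⁆ c))) ?_
  have hB : ∀ (ψ : q →ₗ[k] A) (b : η), ∑ c,
      (∑ i, p i * algebraMap k A (e.repr ⁅x i, e b⁆ c)) * ψ (e c) =
        ∑ i, p i * ψ ⁅x i, e b⁆ := fun ψ b => by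
    simp_rw [Finset.sum_mul]
    rw [Finset.sum_comm]
    simp_rw [mul_assoc, ← Finset.mul_sum, sum_algebraMap_repr_mul]
  rw [contactMatrix, Matrix.fromBlocks_transpose, Matrix.fromBlocks_multiply,
    Matrix.fromBlocks_multiply]
  ext (a | a) (b | b)
  · simp
  · simpa [Matrix.mul_apply, h, mul_comm] using (hB α b).symm
  · simpa [Matrix.mul_apply, h] using (hB α a).symm
  · have h1 := hB (α ∘ₗ (LieAlgebra.ad k q (e a) : q →ₗ[k] q)) b
    have h2 := hB (α ∘ₗ (LieAlgebra.ad k q (e b) : q →ₗ[k] q)) a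
    simp only [LinearMap.comp_apply, LieAlgebra.ad_apply] at h1 h2
    have h3 : ∀ c, α ⁅e c, e b⁆ = -α ⁅e b, e c⁆ := fun c => by rw [← lie_skew, map_neg]
    have h4 : ∀ i, α ⁅x i, ⁅e b, e a⁆⁆ = α ⁅e b, ⁅x i, e a⁆⁆ - α ⁅e a, ⁅x i, e b⁆⁆ := fun i => by
      rw [leibniz_lie, map_add, ← lie_skew, map_neg]; ring
    have h5 : ∀ c, α ⁅e a, e c⁆ * ∑ i, p i * algebraMap k A (e.repr ⁅x i, e b⁆ c) =
        (∑ i, p i * algebraMap k A (e.repr ⁅x i, e b⁆ c)) * α ⁅e a, e c⁆ := fun c => mul_comm _ _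
    simp [Matrix.mul_apply, h, h3, h4, h5, h1, h2, mul_sub, neg_add_eq_sub]

end Contact

section OpenOrbit

variable {k q : Type*} [Field k] [LieRing q] [LieAlgebra k q]

theorem IsCompl.linearMap_ext_basis {k M A ι κ : Type*} [Field k] [AddCommGroup M] [Module k M]
    [AddCommGroup A] [Module k A] {U W : Submodule k M} (h : IsCompl U W) (b : Basis ι k U)
    (c : Basis κ k W) {φ ψ : M →ₗ[k] A} (hb : ∀ i, φ (b i) = ψ (b i))
    (hc : ∀ i, φ (c i) = ψ (c i)) : φ = ψ := by
  ext y
  obtain ⟨u, hu, w, hw, rfl⟩ := Submodule.mem_sup.1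
    (h.sup_eq_top ▸ Submodule.mem_top : y ∈ U ⊔ W)
  have h1 : φ ∘ₗ U.subtype = ψ ∘ₗ U.subtype := b.ext hb
  have h2 : φ ∘ₗ W.subtype = ψ ∘ₗ W.subtype := c.ext hc
  rw [map_add, map_add]
  exact congrArg₂ (· + ·) (LinearMap.congr_fun h1 ⟨u, hu⟩) (LinearMap.congr_fun h2 ⟨w, hw⟩)

theorem IsCompl.derivation_apply_eq_sum {A ι κ ν : Type*} [CommRing A] [Algebra k A] [Fintype ν]
    {U W : Submodule k q} (h : IsCompl U W) (b : Basis ι k U) (c : Basis κ k W)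
    (D : Derivation k A A) (α : q →ₗ[k] A) (p : ν → A) (x : ν → q)
    (hb : ∀ j, D (α (b j)) = ∑ i, p i * α ⁅x i, (b j : q)⁆)
    (hc : ∀ j, D (α (c j)) = ∑ i, p i * α ⁅x i, (c j : q)⁆) (y : q) :
    D (α y) = ∑ i, p i * α ⁅x i, y⁆ := by
  have : (D : A →ₗ[k] A) ∘ₗ α = ∑ i, p i • (α ∘ₗ (LieAlgebra.ad k q (x i) : q →ₗ[k] q)) :=
    h.linearMap_ext_basis b c (fun j => by simpa using hb j) (fun j => by simpa using hc j)
  simpa using LinearMap.congr_fun this y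

/-- If `x ↦ x·γ` maps `l` onto `V*` and some linear form has nonsingular contact matrix,
then some linear form restricting to `γ` on `V` has nonsingular contact matrix. -/
theorem exists_det_contactMatrix_ne_zero [CharZero k] [FiniteDimensional k q]
    {η : Type*} [Fintype η] [DecidableEq η] (e : Basis η k q)
    (V : LieIdeal k q) (l : LieSubalgebra k q)
    (hcompl : IsCompl l.toSubmodule (LieSubmodule.toSubmodule V)) (γ : Dual k ↥V)
    (hsurj : ∀ δ : Dual k ↥V, ∃ x ∈ l, ∀ v : ↥V, δ v = -γ ⁅x, v⁆)
    (α₀ : Dual k q) (h₀ : (contactMatrix e α₀).det ≠ 0) :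
    ∃ α : Dual k q, (∀ v : ↥V, α v = γ v) ∧ (contactMatrix e α).det ≠ 0 := by
  let b := finBasis k l.toSubmodule
  let c := finBasis k ↥V
  let S := MvPolynomial (Option (Fin (finrank k l.toSubmodule))) k
  let t : S := MvPolynomial.X none
  let δ : Dual k ↥V := α₀ ∘ₗ (LieSubmodule.toSubmodule V).subtype - γ
  let γt : ↥V →ₗ[k] S := Algebra.linearMap k S ∘ₗ γ + t • (Algebra.linearMap k S ∘ₗ δ)
  let α : q →ₗ[k] S := LinearMap.ofIsCompl hcompl (b.constr k fun i => MvPolynomial.X (some i)) γt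
  have hαb : ∀ i, α (b i) = MvPolynomial.X (some i) := fun i => by
    rw [LinearMap.ofIsCompl_apply_left, b.constr_basis]
  have hαV : ∀ v : ↥V, α v = algebraMap k S (γ v) + t * algebraMap k S (δ v) := fun v =>
    LinearMap.ofIsCompl_apply_right hcompl v
  choose x _ hx using fun j => hsurj (-c.coord j)
  let N : Matrix _ _ S := Matrix.of fun j i => α ⁅x i, (c j : q)⁆
  obtain ⟨p, hp⟩ : ∃ p : _ → S, ∀ j,
      ∑ i, p i * α ⁅x i, (c j : q)⁆ = N.det * algebraMap k S (δ (c j)) := by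
    let d := fun j => algebraMap k S (δ (c j))
    have : N.mulVec (N.adjugate.mulVec d) = N.det • d := by
      rw [Matrix.mulVec_mulVec, Matrix.mul_adjugate, Matrix.smul_mulVec, Matrix.one_mulVec]
    exact ⟨N.adjugate.mulVec d, fun j =>
      (Finset.sum_congr rfl fun i _ => mul_comm _ _).trans (congrFun this j)⟩
  let D : Derivation k S S := MvPolynomial.mkDerivation k fun o =>
    o.elim N.det fun i => ∑ m, p m * α ⁅x m, (b i : q)⁆
  have hDt : D t = N.det := MvPolynomial.mkDerivation_X _ _ _
  have hD : ∀ y, D (α y) = ∑ i, p i * α ⁅x i, y⁆ := by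
    refine hcompl.derivation_apply_eq_sum b c D α p x (fun i => ?_) fun j => ?_
    · rw [hαb]
      exact MvPolynomial.mkDerivation_X _ _ _
    · rw [hp, hαV, map_add, D.map_algebraMap, D.leibniz, D.map_algebraMap, smul_zero, zero_add,
        zero_add, hDt, smul_eq_mul, mul_comm]
  have haeval : ∀ (s : Option (Fin (finrank k l.toSubmodule)) → k) (v : ↥V),
      ((MvPolynomial.aeval s).toLinearMap ∘ₗ α) v = γ v + s none * δ v := fun s v => by
    rw [LinearMap.comp_apply, hαV, AlgHom.toLinearMap_apply, map_add, map_mul, AlgHom.commutes,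
      AlgHom.commutes, MvPolynomial.aeval_X]
    rfl
  have hf : (contactMatrix e α).det ≠ 0 := by
    intro hf
    let s : Option (Fin (finrank k l.toSubmodule)) → k := fun o => o.elim 1 fun i => α₀ (b i)
    have hs : (MvPolynomial.aeval s).toLinearMap ∘ₗ α = α₀ := by
      refine hcompl.linearMap_ext_basis b c (fun i => ?_) fun j => ?_
      · simp [hαb, s]
      · rw [haeval]
        exact (congrArg _ (one_mul _)).trans (add_sub_cancel _ _)
    apply h₀
    rw [← hs, ← contactMatrix_map]
    exact (AlgHom.map_det _ _).symm.trans (by rw [hf, map_zero])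
  have hN : ¬ t ∣ D t := by
    rintro ⟨g, hg⟩
    have h1 := congrArg (MvPolynomial.aeval fun _ => (0 : k)) (hDt.symm.trans hg)
    have h2 : N.map (MvPolynomial.aeval fun _ => (0 : k)) = 1 := by
      ext j i
      have h3 := haeval (fun _ => 0) ⁅x i, c j⁆
      have h4 := hx i (c j)
      simp only [LinearMap.neg_apply, neg_inj, Basis.coord_apply, Basis.repr_self] at h4
      rw [zero_mul, add_zero, ← h4] at h3
      rw [Matrix.one_apply]
      exact h3.trans (by rw [Finsupp.single_apply])
    rw [AlgHom.map_det, AlgHom.mapMatrix_apply, h2] at h1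
    simp [t] at h1
  have hdvd : ¬ t ∣ (contactMatrix e α).det := fun h =>
    hf (D.eq_zero_of_prime_dvd MvPolynomial.X_prime hN (det_contactMatrix_dvd e α D p x hD) h)
  have : ∃ s : Option (Fin (finrank k l.toSubmodule)) → k,
      s none = 0 ∧ MvPolynomial.eval s (contactMatrix e α).det ≠ 0 := by
    by_contra! h
    exact hdvd (MvPolynomial.X_dvd_of_eval_eq_zero none h)
  obtain ⟨s, hs, hsf⟩ := this
  refine ⟨(MvPolynomial.aeval s).toLinearMap ∘ₗ α, fun v => by rw [haeval, hs]; simp, ?_⟩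
  rw [← contactMatrix_map]
  refine fun h => hsf ?_
  rw [← MvPolynomial.coe_aeval_eq_eval]
  exact (AlgHom.map_det _ _).trans h

end OpenOrbit

section Stabilizer

theorem Submodule.finrank_eq_one_of_forall {k M : Type*} [Field k] [AddCommGroup M] [Module k M]
    {W : Submodule k M} (f : Dual k M) (hf : ∀ w ∈ W, f w = 0 → w = 0) {w : M} (hw : w ∈ W)
    (hw0 : w ≠ 0) : finrank k W = 1 := by
  have hfw : f w ≠ 0 := fun h => hw0 (hf w hw h)
  refine finrank_eq_one (⟨w, hw⟩ : W) (fun h => hw0 (congrArg Subtype.val h)) fun u => ?_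
  refine ⟨f u / f w, Subtype.ext (sub_eq_zero.1 (hf _ (W.sub_mem (W.smul_mem _ hw) u.2) ?_))⟩
  simp [hfw]

variable {k q : Type*} [Field k] [LieRing q] [LieAlgebra k q] {V : LieIdeal k q}
  {l : LieSubalgebra k q} {γ : Dual k ↥V} {α : Dual k q}

theorem exists_add_mem_coadjointStabilizer [FiniteDimensional k q]
    (hab : ∀ v w : q, v ∈ V → w ∈ V → ⁅v, w⁆ = 0)
    (hcompl : IsCompl l.toSubmodule (LieSubmodule.toSubmodule V)) (hα : ∀ v : ↥V, α v = γ v)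
    {x : q} (hx : x ∈ lGamma k V l γ) (hxα : ∀ y ∈ lGamma k V l γ, α ⁅x, y⁆ = 0) :
    ∃ v : ↥V, x + v ∈ coadjointStabilizer k α := by
  let T : l.toSubmodule →ₗ[k] Dual k ↥V := LinearMap.mk₂ k (fun y v => γ ⁅(y : q), v⁆)
    (by simp) (by simp) (by simp) (by simp)
  let φ : Dual k l.toSubmodule :=
    α ∘ₗ (LieAlgebra.ad k q x : q →ₗ[k] q) ∘ₗ l.toSubmodule.subtype
  have hφ : φ ∈ LinearMap.range T.dualMap := by
    rw [LinearMap.range_dualMap_eq_dualAnnihilator_ker, Submodule.mem_dualAnnihilator]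
    exact fun y hy => hxα y ⟨y.2, fun v => LinearMap.congr_fun hy v⟩
  obtain ⟨Ψ, hΨ⟩ := hφ
  obtain ⟨v, rfl⟩ := (evalEquiv k ↥V).surjective Ψ
  have hv : ∀ y ∈ l, α ⁅x, y⁆ = α ⁅y, (v : q)⁆ := fun y hy =>
    (LinearMap.congr_fun hΨ ⟨y, hy⟩).symm.trans (hα ⁅y, v⁆).symm
  refine ⟨v, fun y => ?_⟩
  obtain ⟨u, hu, w, hw, rfl⟩ := Submodule.mem_sup.1
    (hcompl.sup_eq_top ▸ Submodule.mem_top : y ∈ l.toSubmodule ⊔ LieSubmodule.toSubmodule V)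
  have h1 : α ⁅x, w⁆ = 0 := (hα ⁅x, (⟨w, hw⟩ : ↥V)⁆).trans (hx.2 _)
  rw [lie_add, add_lie, add_lie, hab v w v.2 hw, map_add, map_add, map_add, h1, hv u hu,
    ← lie_skew, map_neg, map_zero]
  ring

theorem exists_eq_add_of_mem_coadjointStabilizer
    (hab : ∀ v w : q, v ∈ V → w ∈ V → ⁅v, w⁆ = 0)
    (hcompl : IsCompl l.toSubmodule (LieSubmodule.toSubmodule V)) (hα : ∀ v : ↥V, α v = γ v)
    {x₀ : q} (hx₀ : ∀ v : ↥V, γ v = -γ ⁅x₀, v⁆)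
    {ξ : q} (hξ : ξ ∈ coadjointStabilizer k α) :
    ∃ x ∈ lGamma k V l γ, ∃ v : ↥V, ξ = x + v ∧ (∀ y ∈ lGamma k V l γ, α ⁅x, y⁆ = 0) ∧
      α ξ = α ⁅x₀, x⁆ + α x := by
  obtain ⟨x, hx, v, hv, rfl⟩ := Submodule.mem_sup.1
    (hcompl.sup_eq_top ▸ Submodule.mem_top : ξ ∈ l.toSubmodule ⊔ LieSubmodule.toSubmodule V)
  have hξ' : ∀ y, α ⁅x, y⁆ = α ⁅y, v⁆ := fun y => by
    have := hξ y
    rwa [add_lie, map_add, ← lie_skew v y, map_neg, add_neg_eq_zero] at this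
  refine ⟨x, ⟨hx, fun w => ?_⟩, ⟨v, hv⟩, rfl, fun y hy => ?_, ?_⟩
  · rw [← hα]
    exact (hξ' w).trans (by rw [hab w v w.2 hv, map_zero])
  · rw [hξ']
    exact (hα ⁅y, (⟨v, hv⟩ : ↥V)⁆).trans (hy.2 _)
  · have h1 : α v = -α ⁅x₀, v⁆ :=
      (hα ⟨v, hv⟩).trans ((hx₀ _).trans (by rw [← hα]; rfl))
    rw [map_add, h1, ← hξ', ← lie_skew, map_neg]
    ring

theorem eq_zero_of_mem_coadjointStabilizer [FiniteDimensional k q] (hα : ∀ v : ↥V, α v = γ v)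
    (hsurj : ∀ δ : Dual k ↥V, ∃ x ∈ l, ∀ v : ↥V, δ v = -γ ⁅x, v⁆)
    {v : ↥V} (hv : (v : q) ∈ coadjointStabilizer k α) : v = 0 := by
  refine (forall_dual_apply_eq_zero_iff k v).1 fun δ => ?_
  obtain ⟨x, -, hx⟩ := hsurj δ
  have : α ⁅x, (v : q)⁆ = 0 := by rw [← lie_skew, map_neg, hv, neg_zero]
  rw [hx, ← hα]
  exact neg_eq_zero.2 this

theorem add_smul_mem_lGamma {x₀ : q} (hx₀l : x₀ ∈ l) (hx₀ : ∀ v : ↥V, γ v = -γ ⁅x₀, v⁆) {y : q}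
    (hy : y ∈ lNorm k V l γ) : ∃ c : k, y + c • x₀ ∈ lGamma k V l γ := by
  obtain ⟨hyl, c, hc⟩ := hy
  refine ⟨c, l.add_mem hyl (l.smul_mem c hx₀l), fun v => ?_⟩
  rw [add_lie, smul_lie, map_add, map_smul, hc, hx₀ v, smul_eq_mul]
  ring

/-- If `l_γ` is not contact and some linear form is injective on the stabiliser of `α` restricted
to `l_γ`, then `α` vanishes on this stabiliser. -/
theorem apply_eq_zero_of_not_isContact_lGamma (hnc : ¬ IsContact k ↥(lGamma k V l γ))
    (f : Dual k q) (hf : ∀ x ∈ lGamma k V l γ, (∀ y ∈ lGamma k V l γ, α ⁅x, y⁆ = 0) → f x = 0 →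
      x = 0) {x : q} (hx : x ∈ lGamma k V l γ) (hxα : ∀ y ∈ lGamma k V l γ, α ⁅x, y⁆ = 0) :
    α x = 0 := by
  by_contra h
  let ι := (lGamma k V l γ).toSubmodule.subtype
  have hmem : (⟨x, hx⟩ : ↥(lGamma k V l γ)) ∈ coadjointStabilizer k (α ∘ₗ ι) :=
    fun y => hxα y y.2
  refine hnc ⟨α ∘ₗ ι, Submodule.finrank_eq_one_of_forall (f ∘ₗ ι) (fun w hw hfw => ?_) hmem
    fun h0 => h ?_, _, hmem, h⟩
  · exact Subtype.ext (hf w w.2 (fun y hy => hw ⟨y, hy⟩) hfw)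
  · rw [show x = 0 from congrArg Subtype.val h0, map_zero]

end Stabilizer

/-- for `q = l ⋉ V` of index 1 with `V` an abelian ideal and `L·γ ⊆ V*`
open, if `l_γ` is not contact then `q` is contact iff `ind l_{<γ>} = 0`. -/
theorem stmt3 (k q : Type*) [Field k] [IsAlgClosed k] [CharZero k]
    [LieRing q] [LieAlgebra k q] [FiniteDimensional k q]
    (V : LieIdeal k q) (l : LieSubalgebra k q)
    (hab : ∀ v w : q, v ∈ V → w ∈ V → ⁅v, w⁆ = 0)
    (hcompl : IsCompl l.toSubmodule (LieSubmodule.toSubmodule V))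
    (γ : Module.Dual k ↥V)
    (hsurj : ∀ δ : Module.Dual k ↥V, ∃ x ∈ l, ∀ v : ↥V, δ v = -γ ⁅x, v⁆)
    (hind : HasIndexOne k q)
    (hnc : ¬ IsContact k ↥(lGamma k V l γ)) :
    IsContact k q ↔
      ∃ β : Module.Dual k ↥(lNorm k V l γ), coadjointStabilizer k β = ⊥ := by
  obtain ⟨x₀, hx₀l, hx₀⟩ := hsurj γ
  have hx₀n : x₀ ∈ lNorm k V l γ := ⟨hx₀l, -1, fun v => by rw [hx₀ v]; ring⟩
  have hgn : lGamma k V l γ ≤ lNorm k V l γ := fun x hx =>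
    ⟨hx.1, 0, fun v => by rw [hx.2 v, zero_mul]⟩
  have hdisj : ∀ x ∈ l, ∀ v : ↥V, x + v = 0 → x = 0 := fun x hx v h =>
    Submodule.disjoint_def.1 hcompl.disjoint x hx
      (by rw [eq_neg_of_add_eq_zero_left h]; exact neg_mem v.2)
  have hpos : ∀ α : Dual k q, ∃ ξ ∈ coadjointStabilizer k α, ξ ≠ 0 := fun α => by
    have : coadjointStabilizer k α ≠ ⊥ := fun h => by
      simpa [h] using hind.1 α
    exact Submodule.exists_mem_ne_zero_of_ne_bot this
  constructor
  · rintro ⟨α₀, h1, h2⟩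
    let e := finBasis k q
    obtain ⟨α, hα, hdet⟩ := exists_det_contactMatrix_ne_zero e V l hcompl γ hsurj α₀
      (det_contactMatrix_ne_zero e α₀ h1 h2)
    have hinj : ∀ x ∈ lGamma k V l γ, (∀ y ∈ lGamma k V l γ, α ⁅x, y⁆ = 0) →
        α ⁅x₀, x⁆ + α x = 0 → x = 0 := by
      intro x hx hxα hfx
      obtain ⟨v, hv⟩ := exists_add_mem_coadjointStabilizer hab hcompl hα hx hxα
      refine hdisj x hx.1 v (eq_zero_of_det_contactMatrix_ne_zero e α hdet hv ?_)
      have hvx : α ⁅x₀, (v : q)⁆ = α ⁅x, x₀⁆ := by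
        have := hv x₀
        rw [add_lie, map_add, ← lie_skew (v : q) x₀, map_neg] at this
        linear_combination -this
      have hαv : α v = -α ⁅x₀, (v : q)⁆ := by
        rw [hα, hx₀, ← hα]; rfl
      rw [map_add, hαv, hvx, ← lie_skew, map_neg, neg_neg, add_comm, hfx]
    have hzero : ∀ x ∈ lGamma k V l γ, (∀ y ∈ lGamma k V l γ, α ⁅x, y⁆ = 0) → α x = 0 :=
      fun x hx hxα => apply_eq_zero_of_not_isContact_lGamma hnc
        (α ∘ₗ (LieAlgebra.ad k q x₀ : q →ₗ[k] q) + α) hinj hx hxα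
    obtain ⟨ξ, hξ, hξ0⟩ := hpos α
    obtain ⟨x, hx, v, rfl, hxα, hξx⟩ :=
      exists_eq_add_of_mem_coadjointStabilizer hab hcompl hα hx₀ hξ
    have hne : α ⁅x₀, x⁆ ≠ 0 := fun h => hξ0
      (eq_zero_of_det_contactMatrix_ne_zero e α hdet hξ (by rw [hξx, h, hzero x hx hxα, add_zero]))
    refine ⟨α ∘ₗ (lNorm k V l γ).toSubmodule.subtype, (Submodule.eq_bot_iff _).2 ?_⟩
    rintro ⟨y, hy⟩ hyβ
    have hyα : ∀ z ∈ lNorm k V l γ, α ⁅y, z⁆ = 0 := fun z hz => hyβ ⟨z, hz⟩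
    obtain ⟨c, hc⟩ := add_smul_mem_lGamma hx₀l hx₀ hy
    have hc0 : c = 0 := by
      have h3 := hxα _ hc
      rw [← lie_skew, map_neg, neg_eq_zero, add_lie, map_add, hyα x (hgn hx), zero_add,
        smul_lie, map_smul, smul_eq_mul] at h3
      exact (mul_eq_zero.1 h3).resolve_right hne
    rw [hc0, zero_smul, add_zero] at hc
    have hyg : ∀ z ∈ lGamma k V l γ, α ⁅y, z⁆ = 0 := fun z hz => hyα z (hgn hz)
    refine Subtype.ext (hinj y hc hyg ?_)
    rw [hzero y hc hyg, add_zero, ← lie_skew, map_neg, hyα x₀ hx₀n, neg_zero]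
  · rintro ⟨β, hβ⟩
    obtain ⟨β', hβ'⟩ : ∃ β' : Dual k q, β' ∘ₗ (lNorm k V l γ).toSubmodule.subtype = β :=
      LinearMap.exists_extend (p := (lNorm k V l γ).toSubmodule) β
    let α : Dual k q := LinearMap.ofIsCompl hcompl (β' ∘ₗ l.toSubmodule.subtype) γ
    have hα : ∀ v : ↥V, α v = γ v := LinearMap.ofIsCompl_apply_right hcompl
    have hαβ : ∀ x : ↥(lNorm k V l γ), α x = β x := fun x =>
      (LinearMap.ofIsCompl_apply_left hcompl (⟨x, x.2.1⟩ : l.toSubmodule)).trans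
        (LinearMap.congr_fun hβ' x)
    have hinj : ∀ x ∈ lGamma k V l γ, (∀ y ∈ lGamma k V l γ, α ⁅x, y⁆ = 0) →
        α ⁅x₀, x⁆ = 0 → x = 0 := by
      intro x hx hxα hfx
      have hmem : (⟨x, hgn hx⟩ : ↥(lNorm k V l γ)) ∈ coadjointStabilizer k β := fun y => by
        rw [← hαβ]
        obtain ⟨c, hc⟩ := add_smul_mem_lGamma hx₀l hx₀ y.2
        have h3 := hxα _ hc
        rw [lie_add, lie_smul, map_add, map_smul, ← lie_skew x x₀, map_neg, hfx, neg_zero,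
          smul_zero, add_zero] at h3
        exact h3
      rw [hβ, Submodule.mem_bot] at hmem
      exact congrArg Subtype.val hmem
    have hzero : ∀ x ∈ lGamma k V l γ, (∀ y ∈ lGamma k V l γ, α ⁅x, y⁆ = 0) → α x = 0 :=
      fun x hx hxα => apply_eq_zero_of_not_isContact_lGamma hnc
        (α ∘ₗ (LieAlgebra.ad k q x₀ : q →ₗ[k] q)) hinj hx hxα
    have hstab : ∀ ξ ∈ coadjointStabilizer k α, α ξ = 0 → ξ = 0 := by
      intro ξ hξ hαξ
      obtain ⟨x, hx, v, rfl, hxα, hξx⟩ :=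
        exists_eq_add_of_mem_coadjointStabilizer hab hcompl hα hx₀ hξ
      rw [hαξ, hzero x hx hxα, add_zero] at hξx
      obtain rfl := hinj x hx hxα hξx.symm
      rw [zero_add] at hξ ⊢
      rw [eq_zero_of_mem_coadjointStabilizer hα hsurj hξ]; rfl
    obtain ⟨ξ, hξ, hξ0⟩ := hpos α
    exact ⟨α, Submodule.finrank_eq_one_of_forall α hstab hξ hξ0, ξ, hξ,
      fun h => hξ0 (hstab ξ hξ h)⟩
end

section
/- Let q be a finite-dimensional Lie algebra over an algebraically closed field k of characteristic 0, V ⊆ q an abelian Lie ideal, l ⊆ q a Lie subalgebra with q = l ⊕ V as k-vector spaces. Let γ ∈ V* be such that the linear map l → V*, x ↦ x·γ, is surjective, and assume ind q = 1. If the Lie algebra l_γ is contact but q is not contact, then ind l_{<γ>} = 0, i.e. there exists β ∈ (l_{<γ>})* whose coadjoint stabiliser in l_{<γ>} is zero. -/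
open Module

/-- Extend a linear form on a submodule `p ≤ l` and one on a complement of `l` simultaneously. -/
theorem exists_dual_extend_isCompl {k E : Type*} [Field k] [AddCommGroup E] [Module k E]
    {l V p : Submodule k E} (h : IsCompl l V) (hp : p ≤ l)
    (β : Module.Dual k p) (γ : Module.Dual k V) :
    ∃ α : Module.Dual k E, (∀ x : p, α x = β x) ∧ ∀ v : V, α v = γ v := by
  obtain ⟨b, hb⟩ := LinearMap.exists_extend β
  refine ⟨LinearMap.ofIsCompl h (b ∘ₗ l.subtype) γ, fun x => ?_, fun v => ?_⟩
  · rw [← hb]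
    exact LinearMap.ofIsCompl_apply_left h ⟨(x : E), hp x.2⟩
  · exact LinearMap.ofIsCompl_apply_right h v

/-- A linear form vanishing on the kernel of a surjection onto a dual space is evaluation at a
vector. -/
theorem exists_eq_apply_of_ker_le {k E V : Type*} [Field k] [AddCommGroup E] [Module k E]
    [AddCommGroup V] [Module k V] [FiniteDimensional k V]
    (S : E →ₗ[k] Module.Dual k V) (f : Module.Dual k E)
    (h : LinearMap.ker S ≤ LinearMap.ker f) : ∃ v : V, ∀ y, f y = S y v := by
  have hf : f ∈ LinearMap.range S.dualMap := by
    rw [LinearMap.range_dualMap_eq_dualAnnihilator_ker, Submodule.mem_dualAnnihilator]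
    exact fun y hy => h hy
  obtain ⟨F, rfl⟩ := hf
  obtain ⟨v, rfl⟩ := (Module.evalEquiv k V).surjective F
  exact ⟨v, fun y => by simp⟩

section Semidirect

variable {k q : Type*} [Field k] [LieRing q] [LieAlgebra k q] [FiniteDimensional k q]
  {V : LieIdeal k q} {l : LieSubalgebra k q} {γ : Module.Dual k ↥V}

/-- If `z` spans the stabiliser of `α` in `l_γ`, where `α` extends `γ`, then the stabiliser of `α`
in `q` is spanned by `z + v` for some `v ∈ V`. -/
theorem exists_coadjointStabilizer_eq_span
    (hab : ∀ v w : q, v ∈ V → w ∈ V → ⁅v, w⁆ = 0)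
    (hcompl : IsCompl l.toSubmodule (LieSubmodule.toSubmodule V))
    (hsurj : ∀ δ : Module.Dual k ↥V, ∃ x ∈ l, ∀ v : ↥V, δ v = -γ ⁅x, v⁆)
    {α : Module.Dual k q} (hα : ∀ v : ↥V, α v = γ v) {z : q} (hz : z ∈ lGamma k V l γ)
    (hz0 : ∀ y ∈ lGamma k V l γ, α ⁅z, y⁆ = 0)
    (hzspan : ∀ x ∈ lGamma k V l γ, (∀ y ∈ lGamma k V l γ, α ⁅x, y⁆ = 0) → ∃ t : k, x = t • z) :
    ∃ v : ↥V, coadjointStabilizer k α = Submodule.span k {z + (v : q)} := by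
  have hsum : ∀ x : q, ∃ a ∈ l, ∃ w : ↥V, x = a + w := fun x => by
    have hx : x ∈ l.toSubmodule ⊔ LieSubmodule.toSubmodule V := by
      rw [hcompl.sup_eq_top]; trivial
    obtain ⟨a, ha, w, hw, rfl⟩ := Submodule.mem_sup.1 hx
    exact ⟨a, ha, ⟨w, hw⟩, rfl⟩
  have hαγ : ∀ (x : q) (w : ↥V), α ⁅x, (w : q)⁆ = γ ⁅x, w⁆ := fun x w => hα ⁅x, w⁆
  have hbr : ∀ (x y : q) (w u : ↥V), α ⁅x + (w : q), y + (u : q)⁆ =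
      α ⁅x, y⁆ + γ ⁅x, u⁆ - γ ⁅y, w⁆ := fun x y w u => by
    have hwy : α ⁅(w : q), y⁆ = -γ ⁅y, w⁆ := by rw [← lie_skew, map_neg, hαγ]
    simp only [add_lie, lie_add, map_add, hab _ _ w.2 u.2, map_zero, hwy, hαγ]
    ring
  let S : l →ₗ[k] Module.Dual k ↥V := LinearMap.mk₂ k (fun y w => γ ⁅(y : q), w⁆)
    (fun _ _ _ => by simp) (fun _ _ _ => by simp) (fun _ _ _ => by simp) (fun _ _ _ => by simp)
  let f : Module.Dual k l := α ∘ₗ (LieAlgebra.ad k q z : q →ₗ[k] q) ∘ₗ l.toSubmodule.subtype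
  obtain ⟨v, hv⟩ := exists_eq_apply_of_ker_le S f fun y hy =>
    hz0 y ⟨y.2, fun w => LinearMap.congr_fun (LinearMap.mem_ker.1 hy) w⟩
  have hzv : ∀ y ∈ l, α ⁅z, y⁆ = γ ⁅y, v⁆ := fun y hy => hv ⟨y, hy⟩
  refine ⟨v, le_antisymm (fun ξ hξ => ?_) ?_⟩
  · obtain ⟨x, hx, w, rfl⟩ := hsum ξ
    have hxγ : x ∈ lGamma k V l γ := ⟨hx, fun u => by
      have h := hξ ((0 : q) + u)
      rw [hbr] at h
      simpa using h⟩
    have hxw : ∀ y, α ⁅x, y⁆ = γ ⁅y, w⁆ := fun y => by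
      have h := hξ (y + ((0 : ↥V) : q))
      rw [hbr] at h
      simpa [sub_eq_zero] using h
    obtain ⟨t, rfl⟩ := hzspan x hxγ fun y hy => by rw [hxw, hy.2 w]
    have hw : w - t • v = 0 := (Module.forall_dual_apply_eq_zero_iff k _).1 fun δ => by
      obtain ⟨y, hy, hδ⟩ := hsurj δ
      have h := hxw y
      rw [smul_lie, map_smul, hzv y hy] at h
      rw [hδ, lie_sub, lie_smul, map_sub, map_smul, h, sub_self, neg_zero]
    rw [sub_eq_zero.1 hw]
    exact Submodule.mem_span_singleton.2 ⟨t, by simp⟩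
  · rw [Submodule.span_singleton_le_iff_mem]
    intro y
    obtain ⟨a, ha, u, rfl⟩ := hsum y
    rw [hbr, hzv a ha, hz.2 u]
    ring

end Semidirect

/-- for `q = l ⋉ V` of index 1 with `V` an abelian ideal and `L·γ ⊆ V*`
open, if `l_γ` is contact but `q` is not, then `ind l_{<γ>} = 0`. -/
theorem stmt4 (k q : Type*) [Field k] [IsAlgClosed k] [CharZero k]
    [LieRing q] [LieAlgebra k q] [FiniteDimensional k q]
    (V : LieIdeal k q) (l : LieSubalgebra k q)
    (hab : ∀ v w : q, v ∈ V → w ∈ V → ⁅v, w⁆ = 0)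
    (hcompl : IsCompl l.toSubmodule (LieSubmodule.toSubmodule V))
    (γ : Module.Dual k ↥V)
    (hsurj : ∀ δ : Module.Dual k ↥V, ∃ x ∈ l, ∀ v : ↥V, δ v = -γ ⁅x, v⁆)
    (hind : HasIndexOne k q)
    (hc : IsContact k ↥(lGamma k V l γ)) (hq : ¬ IsContact k q) :
    ∃ β : Module.Dual k ↥(lNorm k V l γ), coadjointStabilizer k β = ⊥ := by
  obtain ⟨β, hβ, z, hz, hβz⟩ := hc
  obtain ⟨α, hαβ, hαγ⟩ := exists_dual_extend_isCompl (p := (lGamma k V l γ).toSubmodule)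
    hcompl (fun x hx => hx.1) β γ
  replace hαγ : ∀ w : ↥V, α w = γ w := hαγ
  have hz0 : ∀ y ∈ lGamma k V l γ, α ⁅(z : q), y⁆ = 0 := fun y hy =>
    (hαβ ⁅z, ⟨y, hy⟩⁆).trans (hz ⟨y, hy⟩)
  have hαz : α z ≠ 0 := fun h => hβz ((hαβ z).symm.trans h)
  have hz_ne : (z : q) ≠ 0 := fun h => hαz (by rw [h, map_zero])
  have hzspan : ∀ x ∈ lGamma k V l γ, (∀ y ∈ lGamma k V l γ, α ⁅x, y⁆ = 0) →
      ∃ t : k, x = t • (z : q) := fun x hx h => by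
    have hz' : (⟨z, hz⟩ : coadjointStabilizer k β) ≠ 0 := fun h0 =>
      hz_ne (congrArg (fun u : coadjointStabilizer k β => ((u : lGamma k V l γ) : q)) h0)
    obtain ⟨t, ht⟩ := (finrank_eq_one_iff_of_nonzero' _ hz').1 hβ
      ⟨⟨x, hx⟩, fun y => (hαβ ⁅(⟨x, hx⟩ : lGamma k V l γ), y⁆).symm.trans (h y y.2)⟩
    exact ⟨t, (congrArg (fun u : coadjointStabilizer k β =>
      ((u : lGamma k V l γ) : q)) ht).symm⟩
  obtain ⟨v, hv⟩ := exists_coadjointStabilizer_eq_span hab hcompl hsurj hαγ z.2 hz0 hzspan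
  have hzv_mem : (z : q) + v ∈ coadjointStabilizer k α :=
    hv ▸ Submodule.mem_span_singleton_self _
  obtain ⟨x₀, hx₀, hx₀γ⟩ := hsurj (-γ)
  replace hx₀γ : ∀ w : ↥V, γ ⁅x₀, w⁆ = γ w := fun w => (neg_injective (hx₀γ w)).symm
  have hzx₀ : α ⁅(z : q), x₀⁆ = γ v := by
    have h := hzv_mem x₀
    have h' : α ⁅(v : q), x₀⁆ = -γ v := by
      rw [← lie_skew, map_neg, ← hx₀γ v]
      exact congrArg _ (hαγ ⁅x₀, v⁆)
    rw [add_lie, map_add, h'] at h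
    exact add_neg_eq_zero.1 h
  have hzv_ne : (z : q) + v ≠ 0 := fun h => by
    refine hz_ne (Submodule.disjoint_def.1 hcompl.disjoint _ z.2.1 ?_)
    rw [eq_neg_of_add_eq_zero_left h]
    exact V.neg_mem v.2
  have hαzv : α z + γ v = 0 := by
    by_contra h
    refine hq ⟨α, by rw [hv, finrank_span_singleton hzv_ne], _, hzv_mem, ?_⟩
    rwa [map_add, hαγ v]
  have hzx₀_ne : α ⁅(z : q), x₀⁆ ≠ 0 := fun h => hαz (by rwa [← hzx₀, h, add_zero] at hαzv)
  have hx₀_mem : x₀ ∈ lNorm k V l γ := ⟨hx₀, 1, fun w => by rw [hx₀γ, one_mul]⟩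
  have hle : lGamma k V l γ ≤ lNorm k V l γ := fun x hx =>
    ⟨hx.1, 0, fun w => by rw [hx.2, zero_mul]⟩
  refine ⟨α ∘ₗ (lNorm k V l γ).toSubmodule.subtype, (Submodule.eq_bot_iff _).2 ?_⟩
  rintro ⟨x, hxl, c, hc⟩ hx
  replace hx : ∀ y ∈ lNorm k V l γ, α ⁅x, y⁆ = 0 := fun y hy => hx ⟨y, hy⟩
  have hy : x - c • x₀ ∈ lGamma k V l γ := ⟨l.sub_mem hxl (l.smul_mem c hx₀), fun w => by
    rw [sub_lie, smul_lie, map_sub, map_smul, hc, hx₀γ, smul_eq_mul, sub_self]⟩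
  have hc0 : c = 0 := by
    have h := hz0 _ hy
    rw [lie_sub, lie_smul, map_sub, map_smul, ← lie_skew, map_neg, hx z (hle z.2), neg_zero,
      zero_sub, neg_eq_zero, smul_eq_mul] at h
    exact (mul_eq_zero.1 h).resolve_right hzx₀_ne
  subst hc0
  rw [zero_smul, sub_zero] at hy
  obtain ⟨t, rfl⟩ := hzspan x hy fun y hy => hx y (hle hy)
  have ht := hx x₀ hx₀_mem
  rw [smul_lie, map_smul, smul_eq_mul] at ht
  exact Subtype.ext (by simp [(mul_eq_zero.1 ht).resolve_right hzx₀_ne])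
end

section
/- Let q be a finite-dimensional Lie algebra over an algebraically closed field k of characteristic 0, V ⊆ q an abelian Lie ideal, l ⊆ q a Lie subalgebra with q = l ⊕ V as k-vector spaces. Let γ ∈ V* be such that the linear map l → V*, x ↦ x·γ, is surjective, and assume ind q = 1. Suppose l_γ is contact and ind l_{<γ>} = 0. Let β ∈ (l_{<γ>})* be a form whose coadjoint stabiliser in l_{<γ>} is zero and let s ∈ l_{<γ>} be a principal element for β, i.e. β(y) = -β(⁅s,y⁆) for all y ∈ l_{<γ>}. Then q is contact if and only if s·γ ≠ γ. -/
open Module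

section PolynomialVectors

open Polynomial

variable {k M ι : Type*} [Field k] [AddCommGroup M] [Module k M] [Fintype ι]

/-- The value at `u` of the polynomial vector with coordinates `p` in the basis `b`. -/
noncomputable def evalVec (b : Basis ι k M) (p : ι → k[X]) (u : k) : M := ∑ j, (p j).eval u • b j

/-- The polynomial obtained by applying a linear form to a polynomial vector. -/
noncomputable def pairVec (b : Basis ι k M) (f : Dual k M) (p : ι → k[X]) : k[X] :=
  ∑ j, C (f (b j)) * p j

theorem eval_pairVec (b : Basis ι k M) (f : Dual k M) (p : ι → k[X]) (u : k) :
    (pairVec b f p).eval u = f (evalVec b p u) := by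
  simp [pairVec, evalVec, eval_finsetSum, mul_comm]

theorem derivative_pairVec (b : Basis ι k M) (f : Dual k M) (p : ι → k[X]) :
    derivative (pairVec b f p) = pairVec b f fun j => derivative (p j) := by
  simp [pairVec]

/-- The Gram matrix of the pencil `B₀ + X B₁`. -/
noncomputable def pencilMatrix (b : Basis ι k M) (B₀ B₁ : M →ₗ[k] Dual k M) :
    Matrix ι ι k[X] :=
  .of fun i j => C (B₀ (b i) (b j)) + X * C (B₁ (b i) (b j))

theorem exists_ne_zero_iff_eval_det_pencilMatrix [DecidableEq ι] (b : Basis ι k M)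
    (B₀ B₁ : M →ₗ[k] Dual k M) (u : k) :
    (∃ x ≠ 0, ∀ y, B₀ y x + u * B₁ y x = 0) ↔ (pencilMatrix b B₀ B₁).det.eval u = 0 := by
  have key : ∀ (v : ι → k) (i : ι),
      ((pencilMatrix b B₀ B₁).map (eval u)).mulVec v i =
        B₀ (b i) (∑ j, v j • b j) + u * B₁ (b i) (∑ j, v j • b j) := by
    intro v i
    simp only [pencilMatrix, Matrix.mulVec, dotProduct, Matrix.map_apply, Matrix.of_apply,
      eval_add, eval_mul, eval_C, eval_X, map_sum, map_smul, smul_eq_mul, Finset.mul_sum,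
      ← Finset.sum_add_distrib]
    exact Finset.sum_congr rfl fun j _ => by ring
  rw [← coe_evalRingHom, RingHom.map_det, ← Matrix.exists_mulVec_eq_zero_iff]
  constructor
  · rintro ⟨x, hx, h⟩
    refine ⟨b.repr x, fun h0 => hx (b.repr.map_eq_zero_iff.1 (DFunLike.coe_injective h0)), ?_⟩
    funext i
    exact (key _ i).trans (by rw [b.sum_repr]; exact h (b i))
  · rintro ⟨v, hv, h⟩
    refine ⟨∑ j, v j • b j, fun h0 => hv ?_, fun y => ?_⟩
    · funext j
      exact Fintype.linearIndependent_iff.1 b.linearIndependent v h0 j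
    · have : B₀.flip (∑ j, v j • b j) + u • B₁.flip (∑ j, v j • b j) = 0 :=
        b.ext fun i => by simpa [key] using (key v i).symm.trans (congrFun h i)
      simpa using LinearMap.congr_fun this y

theorem exists_primitive_multiple [Nonempty ι] {R : Type*} [CommRing R] [IsDomain R]
    [IsPrincipalIdealRing R] (p : ι → R) (hp : p ≠ 0) :
    ∃ (g : R) (p' : ι → R), g ≠ 0 ∧ (∀ j, p j = g * p' j) ∧ ∃ a : ι → R, ∑ j, a j * p' j = 1 := by
  obtain ⟨g, hg⟩ := IsPrincipalIdealRing.principal (Ideal.span (Set.range p))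
  have hdvd : ∀ j, g ∣ p j := fun j =>
    Ideal.mem_span_singleton.1 <| hg.le <| Ideal.subset_span <| Set.mem_range_self j
  choose p' hp' using hdvd
  have hg0 : g ≠ 0 := by
    rintro rfl
    exact hp (funext fun j => by simpa using hp' j)
  have hmem : g ∈ Ideal.span (Set.range p) := hg.ge <| Ideal.mem_span_singleton_self g
  obtain ⟨a, ha⟩ := Ideal.mem_span_range_iff_exists_fun.1 hmem
  refine ⟨g, p', hg0, hp', a, mul_left_cancel₀ hg0 ?_⟩
  rw [Finset.mul_sum, mul_one]
  exact (Finset.sum_congr rfl fun j _ => by rw [hp' j]; ring).trans ha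

theorem exists_polynomial_kernel_vector [Infinite k] (b : Basis ι k M)
    (B₀ B₁ : M →ₗ[k] Dual k M) (h : ∀ u : k, ∃ x ≠ 0, ∀ y, B₀ y x + u * B₁ y x = 0) :
    ∃ p : ι → k[X], (∀ y, pairVec b (B₀ y) p + X * pairVec b (B₁ y) p = 0) ∧
      ∀ u, evalVec b p u ≠ 0 := by
  classical
  have hdet : (pencilMatrix b B₀ B₁).det = 0 := Polynomial.funext fun u => by
    rw [eval_zero, ← exists_ne_zero_iff_eval_det_pencilMatrix]
    exact h u
  obtain ⟨p, hp, hAp⟩ := Matrix.exists_mulVec_eq_zero_iff.2 hdet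
  have : Nonempty ι := by
    by_contra hι
    rw [not_nonempty_iff] at hι
    exact hp (Subsingleton.elim _ _)
  obtain ⟨g, p', hg, hp', a, ha⟩ := exists_primitive_multiple p hp
  refine ⟨p', fun y => Polynomial.funext fun u => ?_, fun u hu => ?_⟩
  · have hb : ∀ i, pairVec b (B₀ (b i)) p' + X * pairVec b (B₁ (b i)) p' = 0 := fun i => by
      refine (mul_eq_zero.1 ?_).resolve_left hg
      refine Eq.trans ?_ (congrFun hAp i)
      simp only [pencilMatrix, Matrix.mulVec, dotProduct, Matrix.of_apply, pairVec, hp',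
        Finset.mul_sum, mul_add, ← Finset.sum_add_distrib]
      exact Finset.sum_congr rfl fun j _ => by ring
    have : B₀.flip (evalVec b p' u) + u • B₁.flip (evalVec b p' u) = 0 :=
      b.ext fun i => by simpa [eval_pairVec] using congrArg (eval u) (hb i)
    simpa [eval_pairVec] using LinearMap.congr_fun this y
  · have h0 : ∀ j, (p' j).eval u = 0 := Fintype.linearIndependent_iff.1 b.linearIndependent _ hu
    simpa [eval_finsetSum, h0] using congrArg (eval u) ha

theorem finite_setOf_degenerate_pencil [FiniteDimensional k M] (B₀ B₁ : M →ₗ[k] Dual k M)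
    (h : ∀ x, (∀ y, B₀ y x = 0) → x = 0) :
    {u : k | ∃ x ≠ 0, ∀ y, B₀ y x + u * B₁ y x = 0}.Finite := by
  classical
  simp only [exists_ne_zero_iff_eval_det_pencilMatrix (finBasis k M)]
  refine Polynomial.finite_setOfPred_isRoot fun h0 => ?_
  obtain ⟨x, hx, hxy⟩ := (exists_ne_zero_iff_eval_det_pencilMatrix (finBasis k M) B₀ B₁ 0).2
    (by rw [h0, eval_zero])
  exact hx (h x fun y => by simpa using hxy y)

theorem eq_zero_of_wronskian_eq_zero [CharZero k] {P Q : k[X]}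
    (h : derivative P * Q = P * derivative Q) {u : k} (hP : P.IsRoot u) (hQ : ¬ Q.IsRoot u) :
    P = 0 := by
  by_contra hP0
  have hQ0 : Q ≠ 0 := by rintro rfl; exact hQ (by simp)
  have hm := (rootMultiplicity_pos hP0).2 hP
  have hP' : derivative P ≠ 0 := fun h0 => by
    rw [eq_C_of_natDegree_eq_zero (derivative_eq_zero.1 h0)] at hP hP0
    simp_all
  have hl := rootMultiplicity_mul (x := u) (mul_ne_zero hP' hQ0)
  have hr := rootMultiplicity_mul (x := u) (h ▸ mul_ne_zero hP' hQ0)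
  rw [derivative_rootMultiplicity_of_root hP, rootMultiplicity_eq_zero hQ] at hl
  rw [← h] at hr
  omega

end PolynomialVectors

section Derivation

variable {k q : Type*} [Field k] [LieRing q] [LieAlgebra k q]

/-- The bilinear form `(y, x) ↦ α ⁅x, y⁆`. -/
def coadjointForm (α : Dual k q) : q →ₗ[k] Dual k q :=
  LinearMap.mk₂ k (fun y x => α ⁅x, y⁆) (by simp) (by simp) (by simp) (by simp)

@[simp]
theorem coadjointForm_apply (α : Dual k q) (x y : q) : coadjointForm α y x = α ⁅x, y⁆ := rfl

theorem exists_coadjoint_eq [FiniteDimensional k q] {α f : Dual k q}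
    (h : ∀ x ∈ coadjointStabilizer k α, f x = 0) : ∃ S : q, ∀ y, α ⁅S, y⁆ = f y := by
  have hf : f ∈ (coadjointForm α).dualMap.range := by
    rw [LinearMap.range_dualMap_eq_dualAnnihilator_ker, Submodule.mem_dualAnnihilator]
    refine fun x hx => h x fun y => ?_
    rw [← lie_skew, map_neg, ← coadjointForm_apply, LinearMap.mem_ker.1 hx]
    simp
  obtain ⟨φ, hφ⟩ := hf
  obtain ⟨S, rfl⟩ := (evalEquiv k q).surjective φ
  exact ⟨S, fun y => LinearMap.congr_fun hφ y⟩

/-- The ratio of `α ξ` to `α (D ξ)` has vanishing derivative along a family of forms `α` with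
stabiliser spanned by `ξ`; here `δ` and `η` are the derivatives of `α` and `ξ`. -/
theorem wronskian_stabilizer_eq_zero [FiniteDimensional k q] (D : LieDerivation k q q)
    {α δ : Dual k q} {ξ η : q} (hξ : ∀ y, α ⁅ξ, y⁆ = 0) (hη : ∀ y, δ ⁅ξ, y⁆ + α ⁅η, y⁆ = 0)
    (hspan : ∀ x ∈ coadjointStabilizer k α, ∃ e : k, x = e • ξ) (hD : α (D ξ) ≠ 0) :
    (δ ξ + α η) * α (D ξ) = α ξ * (δ (D ξ) + α (D η)) := by
  set P := α ξ with hP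
  set Q := α (D ξ) with hQ
  obtain ⟨S, hS⟩ := exists_coadjoint_eq (α := α)
      (f := P • (α ∘ₗ (D : q →ₗ[k] q)) - Q • α) fun x hx => by
    obtain ⟨e, rfl⟩ := hspan x hx
    simp [← hP, ← hQ, mul_comm]
  replace hS : ∀ y, α ⁅S, y⁆ = P * α (D y) - Q * α y := fun y => by simpa using hS y
  have hmem : Q • ξ - P • D ξ + ⁅S, ξ⁆ ∈ coadjointStabilizer k α := fun y => by
    have h1 := hS ⁅ξ, y⁆
    have h2 : ⁅⁅S, ξ⁆, y⁆ = ⁅S, ⁅ξ, y⁆⁆ - ⁅ξ, ⁅S, y⁆⁆ := lie_lie S ξ y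
    rw [LieDerivation.apply_lie_eq_add, map_add, hξ (D y), hξ y] at h1
    simp only [add_lie, sub_lie, smul_lie, map_add, map_sub, map_smul, smul_eq_mul, h2, h1, hξ]
    ring
  obtain ⟨e, he⟩ := hspan _ hmem
  have he0 : e = 0 := by
    refine (mul_eq_zero.1 ?_).resolve_right hD
    have h3 := congrArg (fun z => α (D z)) he
    have h4 : α ⁅D S, ξ⁆ = 0 := by rw [← lie_skew, map_neg, hξ, neg_zero]
    simp only [map_add, map_sub, map_smul, smul_eq_mul, LieDerivation.apply_lie_eq_add, hS,
      h4] at h3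
    linear_combination -h3
  rw [he0, zero_smul] at he
  have h5 := congrArg δ he
  have h6 := hη S
  have h7 := hS η
  rw [← lie_skew ξ S, map_neg] at h6
  rw [← lie_skew, map_neg] at h7
  simp only [map_add, map_sub, map_smul, smul_eq_mul, map_zero] at h5
  linear_combination h5 + h6 + h7

open Polynomial in
theorem exists_ne_zero_mem_stabilizer_apply_eq_zero [CharZero k] [FiniteDimensional k q]
    (D : LieDerivation k q q) (hdeg : ∀ α : Dual k q, ∃ x ≠ 0, x ∈ coadjointStabilizer k α)
    {α₀ : Dual k q} (h₀ : ∀ x ∈ coadjointStabilizer k α₀, α₀ (D x) = 0 → x = 0)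
    (h₀' : ∀ x ∈ coadjointStabilizer k α₀, α₀ x = 0) (α₁ : Dual k q) :
    ∃ x ≠ 0, x ∈ coadjointStabilizer k α₁ ∧ α₁ x = 0 := by
  set δ := α₁ - α₀ with hδ
  set b := finBasis k q
  set ψ : Dual k q := α₀ ∘ₗ (D : q →ₗ[k] q) with hψ
  have hψa : ∀ x, ψ x = α₀ (D x) := fun x => rfl
  obtain ⟨p, hp, hp0⟩ := exists_polynomial_kernel_vector b (coadjointForm α₀) (coadjointForm δ)
    fun u => by
      obtain ⟨x, hx, hxs⟩ := hdeg (α₀ + u • δ)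
      exact ⟨x, hx, fun y => by simpa using hxs y⟩
  have hpu : ∀ u y, α₀ ⁅evalVec b p u, y⁆ + u * δ ⁅evalVec b p u, y⁆ = 0 := fun u y => by
    simpa [eval_pairVec] using congrArg (eval u) (hp y)
  set p' : _ → k[X] := fun j => derivative (p j) with hp'
  set P : k[X] := pairVec b α₀ p + X * pairVec b δ p with hP
  set Q : k[X] := pairVec b ψ p + X * pairVec b (δ ∘ₗ (D : q →ₗ[k] q)) p with hQ
  have hP0 : P.IsRoot 0 := by
    simpa [hP, eval_pairVec] using h₀' (evalVec b p 0) fun y => by simpa using hpu 0 y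
  have hQ0 : ¬ Q.IsRoot 0 := fun h =>
    hp0 0 <| h₀ (evalVec b p 0) (fun y => by simpa using hpu 0 y) <| by
      simpa [hQ, eval_pairVec, hψa] using h
  have hfin := finite_setOf_degenerate_pencil
    (coadjointForm α₀ + ψ.smulRight ψ) (coadjointForm δ) fun x hx => by
      obtain ⟨z, hz, hzs⟩ := hdeg α₀
      have hψz : ψ z ≠ 0 := fun h => hz (h₀ z hzs h)
      have hψx : ψ x = 0 := by
        have h1 := hx z
        have h2 : α₀ ⁅x, z⁆ = 0 := by rw [← lie_skew, map_neg, hzs x, neg_zero]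
        simpa [h2, hψz] using h1
      exact h₀ x (fun y => by simpa [hψx] using hx y) hψx
  have hW : derivative P * Q = P * derivative Q := by
    refine eq_of_infinite_eval_eq _ _ (Set.Infinite.mono ?_
      (hfin.union (Polynomial.finite_setOfPred_isRoot (p := Q)
        fun h => hQ0 (by simp [h]))).infinite_compl)
    intro u hu
    simp only [Set.mem_compl_iff, Set.mem_union, Set.mem_ofPred_eq, not_or, not_exists,
      not_and] at hu
    obtain ⟨hu1, hu2⟩ := hu
    have hinj : ∀ x ∈ coadjointStabilizer k (α₀ + u • δ), ψ x = 0 → x = 0 := fun x hx hψx => by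
      by_contra hx0
      exact hu1 x hx0 fun y => by simpa [hψx] using hx y
    set ξ := evalVec b p u with hξ
    have hξs : ξ ∈ coadjointStabilizer k (α₀ + u • δ) := fun y => by simpa using hpu u y
    have hψξ : ψ ξ ≠ 0 := fun h => hp0 u (hinj ξ hξs h)
    have key := wronskian_stabilizer_eq_zero D (α := α₀ + u • δ) (δ := δ) (ξ := ξ)
      (η := evalVec b p' u) hξs (fun y => by
        have := congrArg (eval u) (congrArg derivative (hp y))
        simp [derivative_pairVec, eval_pairVec, ← hp', ← hξ] at this
        simp
        linear_combination this)
      (fun x hx => ⟨ψ x / ψ ξ, sub_eq_zero.1 <| hinj _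
        (Submodule.sub_mem _ hx (Submodule.smul_mem _ _ hξs)) (by simp [hψξ])⟩)
      (fun h => hu2 (by simpa [hQ, eval_pairVec, ← hξ, hψa] using h))
    simp [hP, hQ, derivative_pairVec, eval_pairVec, ← hp', ← hξ, hψa] at key ⊢
    linear_combination key
  have hPz := eq_zero_of_wronskian_eq_zero hW hP0 hQ0
  refine ⟨evalVec b p 1, hp0 1, fun y => ?_, ?_⟩
  · simpa [hδ] using hpu 1 y
  · simpa [hP, hδ, eval_pairVec] using congrArg (eval 1) hPz

end Derivation

section AbelianIdeal

variable {k q : Type*} [Field k] [LieRing q] [LieAlgebra k q] {V : LieIdeal k q}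
  {l : LieSubalgebra k q}

theorem exists_add_eq_of_isCompl (hcompl : IsCompl l.toSubmodule (LieSubmodule.toSubmodule V))
    (z : q) : ∃ x ∈ l, ∃ v : V, x + v = z := by
  obtain ⟨x, hx, v, hv, h⟩ := Submodule.mem_sup.1 (hcompl.sup_eq_top ▸ Submodule.mem_top (x := z))
  exact ⟨x, hx, ⟨v, hv⟩, h⟩

/-- The projection of `l ⋉ V` onto the abelian ideal `V` along `l`, as a derivation. -/
noncomputable def projectionDerivation (hab : ∀ v w : q, v ∈ V → w ∈ V → ⁅v, w⁆ = 0)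
    (hcompl : IsCompl l.toSubmodule (LieSubmodule.toSubmodule V)) : LieDerivation k q q where
  toLinearMap := Submodule.projection _ _ hcompl.symm
  leibniz' a b := by
    have hl : ∀ x ∈ l, Submodule.projection _ _ hcompl.symm x = 0 := fun x hx =>
      (Submodule.projection_apply_eq_zero_iff hcompl.symm).2 hx
    have hV : ∀ v ∈ V, Submodule.projection _ _ hcompl.symm v = v := fun v hv =>
      Submodule.projection_apply_of_mem_left hcompl.symm hv
    obtain ⟨x, hx, v, rfl⟩ := exists_add_eq_of_isCompl hcompl a
    obtain ⟨y, hy, w, rfl⟩ := exists_add_eq_of_isCompl hcompl b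
    simp only [lie_add, add_lie, map_add, hl x hx, hl y hy, hl _ (l.lie_mem hx hy), hV v v.2,
      hV w w.2, hab v w v.2 w.2, hab w v w.2 v.2, hV _ (lie_mem_right k q V x w w.2),
      hV _ (lie_mem_left k q V v y v.2), zero_add, add_zero]
    rw [← lie_skew y]
    abel

theorem projectionDerivation_add (hab : ∀ v w : q, v ∈ V → w ∈ V → ⁅v, w⁆ = 0)
    (hcompl : IsCompl l.toSubmodule (LieSubmodule.toSubmodule V)) {x : q} (hx : x ∈ l) (v : V) :
    projectionDerivation hab hcompl (x + v) = v := by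
  change Submodule.projection _ _ hcompl.symm (x + v) = v
  rw [map_add, (Submodule.projection_apply_eq_zero_iff hcompl.symm).2 hx,
    Submodule.projection_apply_of_mem_left hcompl.symm v.2, zero_add]

theorem exists_dual_extending (hcompl : IsCompl l.toSubmodule (LieSubmodule.toSubmodule V))
    (γ : Dual k V) (n : Submodule k q) (hn : n ≤ l.toSubmodule) (β : Dual k n) :
    ∃ α : Dual k q, (∀ y : n, α y = β y) ∧ ∀ v : V, α v = γ v := by
  obtain ⟨φ, hφ⟩ := LinearMap.exists_extend β
  refine ⟨LinearMap.ofIsCompl hcompl (φ ∘ₗ l.toSubmodule.subtype) γ, fun y => ?_, fun v => ?_⟩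
  · rw [← hφ]
    exact LinearMap.ofIsCompl_apply_left hcompl ⟨y, hn y.2⟩
  · exact LinearMap.ofIsCompl_apply_right hcompl v

/-- Consequences of stabilising a form `α` that restricts to `γ` on `V` and to a form `β` with
trivial stabiliser and principal element `s` on `l_{<γ>}`, where `s·γ = c γ`. -/
theorem add_mem_coadjointStabilizer (hab : ∀ v w : q, v ∈ V → w ∈ V → ⁅v, w⁆ = 0)
    {γ : Dual k V} (hsurj : ∀ δ : Dual k V, ∃ x ∈ l, ∀ v : V, δ v = -γ ⁅x, v⁆)
    {β : Dual k (lNorm k V l γ)} (hβ : coadjointStabilizer k β = ⊥)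
    {s : lNorm k V l γ} (hs : ∀ y : lNorm k V l γ, β y = -β ⁅s, y⁆)
    {c : k} (hc : ∀ v : V, γ ⁅(s : q), v⁆ = -(c * γ v))
    {α : Dual k q} (hαβ : ∀ y : lNorm k V l γ, α y = β y) (hαγ : ∀ v : V, α v = γ v)
    {x : q} (hx : x ∈ l) {v : V} (hmem : x + v ∈ coadjointStabilizer k α) :
    (γ v = 0 → x + v = 0) ∧ α (x + v) = (1 - c) * γ v := by
  have hVl : ∀ (v : V) (y : q), α ⁅(v : q), y⁆ = -γ ⁅y, v⁆ := fun v y => by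
    rw [← lie_skew, map_neg, ← LieSubmodule.coe_bracket, hαγ]
  have hxγ : ∀ w : V, γ ⁅x, w⁆ = 0 := fun w => by
    have := hmem w
    rwa [add_lie, hab v w v.2 w.2, add_zero, ← LieSubmodule.coe_bracket, hαγ] at this
  have hxn : x ∈ lNorm k V l γ := ⟨hx, 0, fun w => by rw [hxγ, zero_mul]⟩
  set X : lNorm k V l γ := ⟨x, hxn⟩ with hX
  have hXy : ∀ y : lNorm k V l γ, β ⁅X, y⁆ = γ ⁅(y : q), v⁆ := fun y => by
    have := hmem y
    rw [add_lie, map_add, hVl] at this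
    rw [← hαβ]
    exact add_neg_eq_zero.1 this
  constructor
  · intro hv
    have hX0 : X = 0 := (Submodule.mem_bot k).1 <| hβ ▸ fun y : lNorm k V l γ => by
      obtain ⟨-, d, hd⟩ := y.2
      rw [hXy, hd, hv, mul_zero]
    have hx0 : x = 0 := congrArg Subtype.val hX0
    have hv0 : v = 0 := (forall_dual_apply_eq_zero_iff k v).1 fun δ => by
      obtain ⟨y, hy, hyδ⟩ := hsurj δ
      have := hmem y
      rw [hx0, zero_add, hVl] at this
      rw [hyδ, this]
    rw [hx0, hv0, zero_add]
    rfl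
  · have h1 := hs X
    rw [← lie_skew, map_neg, hXy, hc] at h1
    rw [map_add, hαγ, show α x = β X from hαβ X, h1]
    ring

end AbelianIdeal

/-- for `q = l ⋉ V` of index 1 with `V` an abelian ideal, `L·γ ⊆ V*` open,
`l_γ` contact and `ind l_{<γ>} = 0` with principal element `s`, `q` is contact
iff `s·γ ≠ γ`. -/
theorem stmt5 (k q : Type*) [Field k] [IsAlgClosed k] [CharZero k]
    [LieRing q] [LieAlgebra k q] [FiniteDimensional k q]
    (V : LieIdeal k q) (l : LieSubalgebra k q)
    (hab : ∀ v w : q, v ∈ V → w ∈ V → ⁅v, w⁆ = 0)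
    (hcompl : IsCompl l.toSubmodule (LieSubmodule.toSubmodule V))
    (γ : Module.Dual k ↥V)
    (hsurj : ∀ δ : Module.Dual k ↥V, ∃ x ∈ l, ∀ v : ↥V, δ v = -γ ⁅x, v⁆)
    (hind : HasIndexOne k q)
    (hc : IsContact k ↥(lGamma k V l γ))
    (β : Module.Dual k ↥(lNorm k V l γ)) (hβ : coadjointStabilizer k β = ⊥)
    (s : ↥(lNorm k V l γ)) (hs : ∀ y : ↥(lNorm k V l γ), β y = -β ⁅s, y⁆) :
    IsContact k q ↔ ¬ (∀ v : ↥V, -γ ⁅(s : q), v⁆ = γ v) := by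

  obtain ⟨α, hαβ, hαγ⟩ := exists_dual_extending hcompl γ (lNorm k V l γ).toSubmodule
    (fun x hx => hx.1) β
  have hnz : ∀ α' : Dual k q, ∃ x ≠ 0, x ∈ coadjointStabilizer k α' := fun α' => by
    obtain ⟨x, hx⟩ := finrank_pos_iff_exists_ne_zero.1 (hind.1 α')
    exact ⟨x, fun h => hx (Subtype.ext h), x.2⟩
  obtain ⟨-, d, hd⟩ := s.2
  have hdγ : ∀ v : V, γ ⁅(s : q), v⁆ = -(-d * γ v) := fun v => by rw [hd]; ring
  constructor
  · rintro ⟨α₁, hfin, ξ, hξ, hξ0⟩ hsγ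
    have h1 : ∀ v : V, γ ⁅(s : q), v⁆ = -(1 * γ v) := fun v => by rw [← hsγ v]; ring
    obtain ⟨x, hx, hxs, hx0⟩ := exists_ne_zero_mem_stabilizer_apply_eq_zero
      (projectionDerivation hab hcompl) hnz (α₀ := α)
      (fun z hz hz0 => by
        obtain ⟨x, hx, v, rfl⟩ := exists_add_eq_of_isCompl hcompl z
        rw [projectionDerivation_add hab hcompl hx, hαγ] at hz0
        exact (add_mem_coadjointStabilizer hab hsurj hβ hs h1 hαβ hαγ hx hz).1 hz0)
      (fun z hz => by
        obtain ⟨x, hx, v, rfl⟩ := exists_add_eq_of_isCompl hcompl z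
        rw [(add_mem_coadjointStabilizer hab hsurj hβ hs h1 hαβ hαγ hx hz).2]
        ring) α₁
    obtain ⟨e, he⟩ := (finrank_eq_one_iff_of_nonzero' (⟨x, hxs⟩ : coadjointStabilizer k α₁)
      (fun h => hx (congrArg Subtype.val h))).1 hfin ⟨ξ, hξ⟩
    apply hξ0
    rw [← show e • x = ξ from congrArg Subtype.val he, map_smul, hx0, smul_zero]
  · intro hsγ
    have hd1 : 1 + d ≠ 0 := fun h => hsγ fun v => by
      rw [hd]
      linear_combination -γ v * h
    obtain ⟨z, hz, hzs⟩ := hnz α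
    obtain ⟨x, hx, v, rfl⟩ := exists_add_eq_of_isCompl hcompl z
    have hα0 : ∀ z ∈ coadjointStabilizer k α, α z = 0 → z = 0 := fun z hz hz0 => by
      obtain ⟨x, hx, v, rfl⟩ := exists_add_eq_of_isCompl hcompl z
      obtain ⟨h1, h2⟩ := add_mem_coadjointStabilizer hab hsurj hβ hs hdγ hαβ hαγ hx hz
      refine h1 ((mul_eq_zero.1 (h2.symm.trans hz0)).resolve_left fun h => hd1 ?_)
      linear_combination h
    have hne : α (x + v) ≠ 0 := fun h => hz (hα0 _ hzs h)
    refine ⟨α, (finrank_eq_one_iff_of_nonzero' (⟨x + v, hzs⟩ : coadjointStabilizer k α)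
      (fun h => hz (congrArg Subtype.val h))).2 fun w => ⟨α w / α (x + v), Subtype.ext ?_⟩,
      x + v, hzs, hne⟩
    refine (sub_eq_zero.1 (hα0 _ (Submodule.sub_mem _ w.2 (Submodule.smul_mem _ _ hzs)) ?_)).symm
    rw [map_sub, map_smul, smul_eq_mul, div_mul_cancel₀ _ hne, sub_self]
end

section
/- Let k be an algebraically closed field of characteristic 0 and let q be a finite-dimensional Lie algebra over k with ind q = 1 and dim q = n. Fix a basis b_0, …, b_{n−1} of q and suppose there is a nonzero polynomial F ∈ k[X_0, …, X_{n−1}], homogeneous of some degree d ≥ 1, which is a coadjoint invariant of q: for every ξ ∈ q and every α ∈ q*, the sum over i of α(⁅ξ, b_i⁆) · (∂F/∂X_i)(α(b_0), …, α(b_{n−1})) equals 0. Then q is contact. -/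
open Module

section

variable {k q : Type*} [Field k] [LieRing q] [LieAlgebra k q]

/-- The Kirillov form `(ξ, y) ↦ α ⁅ξ, y⁆` perturbed by the rank one form `l ⊗ l`. -/
noncomputable def perturbedKirillovForm (α l : Dual k q) : q →ₗ[k] q →ₗ[k] k :=
  (LieModule.toEnd k q q : q →ₗ[k] Module.End k q).compr₂ α + l.smulRight l

theorem perturbedKirillovForm_apply (α l : Dual k q) (ξ y : q) :
    perturbedKirillovForm α l ξ y = α ⁅ξ, y⁆ + l ξ * l y := by
  simp [perturbedKirillovForm]

theorem finrank_coadjointStabilizer_le_one {α l : Dual k q}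
    (h : (perturbedKirillovForm α l).SeparatingLeft) :
    finrank k (coadjointStabilizer k α) ≤ 1 := by
  have hinj : Function.Injective (l.domRestrict (coadjointStabilizer k α)) := by
    rw [injective_iff_map_eq_zero]
    rintro ⟨ξ, hξ⟩ hl
    replace hl : l ξ = 0 := hl
    refine Subtype.ext (h ξ fun y => ?_)
    rw [perturbedKirillovForm_apply, hξ y, hl, zero_mul, add_zero]
  simpa using LinearMap.finrank_le_finrank_of_injective hinj

theorem exists_separatingLeft_perturbedKirillovForm {β : Dual k q}
    (h : finrank k (coadjointStabilizer k β) = 1) :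
    ∃ l : Dual k q, (perturbedKirillovForm β l).SeparatingLeft := by
  obtain ⟨⟨v, hv⟩, hv0, hspan⟩ := finrank_eq_one_iff'.mp h
  have hv0' : v ≠ 0 := fun h0 => hv0 (Subtype.ext h0)
  obtain ⟨l, hl⟩ : ∃ l : Dual k q, l v ≠ 0 := by
    by_contra! hl
    exact hv0' ((forall_dual_apply_eq_zero_iff k v).mp hl)
  refine ⟨l, fun ξ hξ => ?_⟩
  simp only [perturbedKirillovForm_apply] at hξ
  have hlξ : l ξ = 0 := by
    have hvξ := hξ v
    rw [← lie_skew, map_neg, hv ξ, neg_zero, zero_add] at hvξ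
    exact (mul_eq_zero.mp hvξ).resolve_right hl
  have hξ' : ξ ∈ coadjointStabilizer k β := fun y => by simpa [hlξ] using hξ y
  obtain ⟨c, hc⟩ := hspan ⟨ξ, hξ'⟩
  replace hc : c • v = ξ := congrArg Subtype.val hc
  have hc0 : c = 0 := by
    rw [← hc, map_smul, smul_eq_mul] at hlξ
    exact (mul_eq_zero.mp hlξ).resolve_right hl
  rw [← hc, hc0, zero_smul]

variable {ι : Type*}

theorem exists_dual_eval_ne_zero [Infinite k] (b : Basis ι k q) {P : MvPolynomial ι k}
    (hP : P ≠ 0) : ∃ α : Dual k q, MvPolynomial.eval (fun j => α (b j)) P ≠ 0 := by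
  by_contra! h
  refine hP (MvPolynomial.funext fun x => ?_)
  simpa only [b.constr_basis, map_zero] using h (b.constr k x)

variable [Fintype ι]

/-- The determinant of `perturbedKirillovForm α l`, as a polynomial in the values of `α` on the
basis `b`. -/
noncomputable def perturbedKirillovDet [DecidableEq ι] (b : Basis ι k q) (l : Dual k q) :
    MvPolynomial ι k :=
  (Matrix.of fun i j => ∑ m, MvPolynomial.C (b.repr ⁅b i, b j⁆ m) * MvPolynomial.X m +
    MvPolynomial.C (l (b i) * l (b j))).det

theorem eval_perturbedKirillovDet [DecidableEq ι] (b : Basis ι k q) (l α : Dual k q) :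
    MvPolynomial.eval (fun j => α (b j)) (perturbedKirillovDet b l) =
      (LinearMap.toMatrix₂ b b (perturbedKirillovForm α l)).det := by
  rw [perturbedKirillovDet, RingHom.map_det]
  congr 1
  ext i j
  have hα : ∑ m, b.repr ⁅b i, b j⁆ m * α (b m) = α ⁅b i, b j⁆ := by
    simpa only [map_sum, map_smul, smul_eq_mul] using congrArg α (b.sum_repr ⁅b i, b j⁆)
  simp [LinearMap.toMatrix₂_apply, perturbedKirillovForm_apply, hα]

theorem apply_sum_eval_pderiv_smul (b : Basis ι k q) {F : MvPolynomial ι k} {d : ℕ}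
    (hF : F.IsHomogeneous d) (α : Dual k q) :
    α (∑ i, MvPolynomial.eval (fun j => α (b j)) (MvPolynomial.pderiv i F) • b i) =
      d * MvPolynomial.eval (fun j => α (b j)) F := by
  have h := congrArg (MvPolynomial.eval fun j => α (b j)) hF.sum_X_mul_pderiv
  simpa [mul_comm] using h

end

/-- a Lie algebra of index 1 admitting a nonconstant homogeneous
polynomial coadjoint invariant is contact. -/
theorem stmt13 (k q : Type*) [Field k] [IsAlgClosed k] [CharZero k]
    [LieRing q] [LieAlgebra k q] [FiniteDimensional k q]
    (n : ℕ) (b : Basis (Fin n) k q)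
    (hind : HasIndexOne k q)
    (F : MvPolynomial (Fin n) k) (hF0 : F ≠ 0) (d : ℕ) (hd : 1 ≤ d)
    (hhom : F.IsHomogeneous d)
    (hinv : ∀ (ξ : q) (α : Module.Dual k q),
      ∑ i, α ⁅ξ, b i⁆ *
        MvPolynomial.eval (fun j => α (b j)) (MvPolynomial.pderiv i F) = 0) :
    IsContact k q := by
  have : Infinite k := IsAlgClosed.instInfinite
  obtain ⟨hpos, β, hβ⟩ := hind
  obtain ⟨l, hl⟩ := exists_separatingLeft_perturbedKirillovForm hβ
  have hD : perturbedKirillovDet b l ≠ 0 := by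
    intro h0
    apply (LinearMap.separatingLeft_iff_det_ne_zero b).mp hl
    rw [← eval_perturbedKirillovDet, h0, map_zero]
  obtain ⟨α, hα⟩ := exists_dual_eval_ne_zero b (mul_ne_zero hF0 hD)
  rw [map_mul, eval_perturbedKirillovDet] at hα
  have hsep := (LinearMap.separatingLeft_iff_det_ne_zero b).mpr (right_ne_zero_of_mul hα)
  refine ⟨α, (finrank_coadjointStabilizer_le_one hsep).antisymm (hpos α),
    ∑ i, MvPolynomial.eval (fun j => α (b j)) (MvPolynomial.pderiv i F) • b i, fun ξ => ?_, ?_⟩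
  · rw [← lie_skew, map_neg, neg_eq_zero, ← hinv ξ α]
    simp [lie_sum, mul_comm]
  · rw [apply_sum_eval_pderiv_smul b hhom]
    exact mul_ne_zero (Nat.cast_ne_zero.mpr (by lia)) (left_ne_zero_of_mul hα)
end

section
/- Let q be a finite-dimensional Lie algebra over a field k of characteristic 0 with ind q = 1 and suppose that every element x of the radical of q is ad-nilpotent, i.e. ad(x) : q → q is a nilpotent endomorphism. Then q is contact: there exists α ∈ q* with dim q_α = 1 and α(q_α) ≠ 0. -/
open Module

theorem hasTrivialRadical_quotient_radical (k q : Type*) [Field k]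
    [LieRing q] [LieAlgebra k q] [FiniteDimensional k q] :
    LieAlgebra.HasTrivialRadical k (q ⧸ LieAlgebra.radical k q) := by
  rw [LieAlgebra.hasTrivialRadical_iff_no_abelian_ideals]
  intro I hI
  let r := LieAlgebra.radical k q
  let π : q →ₗ⁅k⁆ q ⧸ r :=
    { (LieSubmodule.Quotient.mk' r : q →ₗ[k] q ⧸ r) with
      map_lie' := fun {x y} => LieSubmodule.Quotient.mk_bracket r x y }
  have hπ : ∀ x, π x = 0 ↔ x ∈ r := fun x => LieSubmodule.Quotient.mk_eq_zero r
  have hle : LieAlgebra.derivedSeriesOfIdeal k q 1 (I.comap π) ≤ r := by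
    rw [LieAlgebra.derivedSeriesOfIdeal_succ, LieAlgebra.derivedSeriesOfIdeal_zero,
      LieSubmodule.lie_le_iff]
    intro x hx y hy
    rw [LieIdeal.mem_comap] at hx hy
    rw [← hπ, LieHom.map_lie]
    simpa using congrArg Subtype.val
      (LieModule.IsTrivial.trivial (L := I) (M := I) ⟨_, hx⟩ ⟨_, hy⟩)
  have hsol : LieAlgebra.IsSolvable (I.comap π) := by
    obtain ⟨n, hn⟩ := LieAlgebra.IsSolvable.solvable k r
    rw [LieIdeal.derivedSeries_eq_bot_iff] at hn
    refine LieAlgebra.IsSolvable.mk (R := k) (k := n + 1)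
      ((LieIdeal.derivedSeries_eq_bot_iff _ _).mpr ?_)
    rw [LieAlgebra.derivedSeriesOfIdeal_add, ← le_bot_iff, ← hn]
    exact LieAlgebra.derivedSeriesOfIdeal_mono hle n
  rw [LieAlgebra.LieIdeal.solvable_iff_le_radical] at hsol
  rw [eq_bot_iff]
  intro y hy
  obtain ⟨x, rfl⟩ := LieSubmodule.Quotient.surjective_mk' r y
  exact (hπ x).2 (hsol hy)

theorem linearMap_eq_zero_of_lie_of_isKilling {k s : Type*} [Field k] [LieRing s] [LieAlgebra k s]
    [FiniteDimensional k s] [LieAlgebra.IsKilling k s] (χ : Module.Dual k s)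
    (hχ : ∀ x y : s, χ ⁅x, y⁆ = 0) : χ = 0 := by
  have hK := LieAlgebra.IsKilling.killingForm_nondegenerate k s
  obtain ⟨a, rfl⟩ := (LinearMap.BilinForm.toDual (killingForm k s) hK).surjective χ
  have ha : a ∈ LieAlgebra.center k s := by
    rw [LieModule.mem_maxTrivSubmodule]
    intro y
    rw [← lie_skew, neg_eq_zero]
    refine hK.1 _ fun z => ?_
    rw [LieModule.traceForm_apply_lie_apply]
    exact hχ y z
  have : a = 0 := by simpa using ha
  simp [this]

theorem trace_ad_eq_zero {k q : Type*} [Field k] [CharZero k]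
    [LieRing q] [LieAlgebra k q] [FiniteDimensional k q]
    (hnil : ∀ x ∈ LieAlgebra.radical k q, IsNilpotent (LieAlgebra.ad k q x)) (x : q) :
    LinearMap.trace k q (LieAlgebra.ad k q x) = 0 := by
  have := hasTrivialRadical_quotient_radical k q
  let r := LieAlgebra.radical k q
  let χ : q →ₗ[k] k := LinearMap.trace k q ∘ₗ (LieAlgebra.ad k q : q →ₗ[k] Module.End k q)
  have hr : r.toSubmodule ≤ LinearMap.ker χ := fun y hy => by
    exact (LinearMap.isNilpotent_trace_of_isNilpotent (hnil y hy)).eq_zero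
  have h0 := linearMap_eq_zero_of_lie_of_isKilling (k := k) (s := q ⧸ r)
    (r.toSubmodule.liftQ χ hr) (by
    intro a b
    obtain ⟨a, rfl⟩ := LieSubmodule.Quotient.surjective_mk' r a
    obtain ⟨b, rfl⟩ := LieSubmodule.Quotient.surjective_mk' r b
    change LinearMap.trace k q (LieAlgebra.ad k q ⁅a, b⁆) = 0
    have h : LieAlgebra.ad k q ⁅a, b⁆ =
        LieAlgebra.ad k q a * LieAlgebra.ad k q b - LieAlgebra.ad k q b * LieAlgebra.ad k q a := by
      ext z
      simp
    rw [h, map_sub, LinearMap.trace_mul_comm, sub_self])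
  exact LinearMap.congr_fun h0 (LieSubmodule.Quotient.mk' r x)

open Matrix in
theorem det_mul_mul_card_add_one_eq_zero {ι R : Type*} [Fintype ι] [DecidableEq ι] [CommRing R]
    [IsDomain R] {M T : Matrix ι ι R} {φ v : ι → R} {f : R} (hM : Mᵀ = -M) (hv : v ᵥ* M = 0)
    (hφ : φ ⬝ᵥ v ≠ 0) (hT : Tᵀ * M + M * T = f • M)
    (hTv : T *ᵥ v = -(Fintype.card ι * f) • v) (htr : T.trace = 0) :
    (M + vecMulVec φ φ).det * f * (Fintype.card ι + 1) = 0 := by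
  set N := M + vecMulVec φ φ with hN
  set A := N.adjugate
  set g := N.det
  have hv' : M *ᵥ v = 0 := by
    rw [← vecMul_transpose, hM, vecMul_neg, hv, neg_zero]
  have hAN : A * N = g • 1 := adjugate_mul N
  have hNA : N * A = g • 1 := mul_adjugate N
  have hAφ : (φ ⬝ᵥ v) • (A *ᵥ φ) = g • v := by
    have : N *ᵥ v = (φ ⬝ᵥ v) • φ := by
      rw [hN, add_mulVec, hv', zero_add, vecMulVec_mulVec]
      ext; simp [mul_comm]
    rw [← mulVec_smul, ← this, mulVec_mulVec, hAN, smul_mulVec, one_mulVec]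
  have hφA : (φ ⬝ᵥ v) • (φ ᵥ* A) = g • v := by
    have : v ᵥ* N = (φ ⬝ᵥ v) • φ := by
      rw [hN, vecMul_add, hv, zero_add, vecMul_vecMulVec, dotProduct_comm]
    rw [← smul_vecMul, ← this, vecMul_vecMul, hNA, vecMul_smul, vecMul_one]
  have hTN : Tᵀ * N + N * T = f • M + vecMulVec (φ ᵥ* T) φ + vecMulVec φ (φ ᵥ* T) := by
    rw [← hT, hN, mul_add, add_mul, mul_vecMulVec, vecMulVec_mul, mulVec_transpose]
    abel
  have h0 : (A * (Tᵀ * N + N * T)).trace = 0 := by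
    rw [mul_add, trace_add, trace_mul_comm, Matrix.mul_assoc, hNA, ← Matrix.mul_assoc, hAN]
    simp [htr]
  have hψ : (φ ᵥ* T) ⬝ᵥ v = -(Fintype.card ι * f) * (φ ⬝ᵥ v) := by
    rw [← dotProduct_mulVec, hTv, dotProduct_smul, smul_eq_mul]
  have hAM : A * M = g • 1 - vecMulVec (A *ᵥ φ) φ := by
    rw [← hAN, hN, mul_add, mul_vecMulVec, add_sub_cancel_right]
  rw [hTN, mul_add, mul_add, trace_add, trace_add, Matrix.mul_smul, hAM, trace_smul, trace_sub,
    trace_smul, trace_one, mul_vecMulVec, mul_vecMulVec, trace_vecMulVec, trace_vecMulVec,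
    trace_vecMulVec, dotProduct_comm (A *ᵥ (φ ᵥ* T)) φ, dotProduct_mulVec φ A (φ ᵥ* T)] at h0
  have e1 := congrArg (φ ⬝ᵥ ·) hAφ
  have e2 := congrArg ((φ ᵥ* T) ⬝ᵥ ·) hAφ
  have e3 := congrArg ((φ ᵥ* T) ⬝ᵥ ·) hφA
  simp only [dotProduct_smul, smul_eq_mul, hψ] at e1 e2 e3
  rw [dotProduct_comm (φ ᵥ* A), dotProduct_comm (A *ᵥ φ) (φ ᵥ* T)] at h0
  simp only [smul_eq_mul, dotProduct_comm (A *ᵥ φ) φ] at h0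
  apply mul_left_cancel₀ hφ
  linear_combination -(φ ⬝ᵥ v) * h0 - f * e1 + e2 + e3

section LieLinearForm

open MvPolynomial Matrix

variable {k q ι : Type*} [Field k] [LieRing q] [LieAlgebra k q]
  (b : Basis ι k q)

/-- The embedding of a Lie algebra into its symmetric algebra, as linear polynomials in the
elements of a basis. -/
noncomputable def symEmbed : q →ₗ[k] MvPolynomial ι k := b.constr k X

/-- The derivation of the symmetric algebra that extends the adjoint action of `y`. -/
noncomputable def symAd (y : q) : Derivation k (MvPolynomial ι k) (MvPolynomial ι k) :=
  mkDerivation k fun s => symEmbed b ⁅y, b s⁆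

/-- The matrix of brackets of basis elements, with entries in the symmetric algebra. -/
noncomputable def bracketMatrix : Matrix ι ι (MvPolynomial ι k) :=
  Matrix.of fun i l => symEmbed b ⁅b i, b l⁆

theorem symEmbed_basis (i : ι) : symEmbed b (b i) = X i := by simp [symEmbed]

theorem transpose_bracketMatrix : (bracketMatrix b)ᵀ = -bracketMatrix b := by
  ext1 i l
  change symEmbed b ⁅b l, b i⁆ = -symEmbed b ⁅b i, b l⁆
  rw [← map_neg, lie_skew]

variable [Fintype ι]

/-- The matrix of `ad c`, for an element `c` of the Lie algebra with coefficients in its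
symmetric algebra. -/
noncomputable def adMatrix (c : ι → MvPolynomial ι k) : Matrix ι ι (MvPolynomial ι k) :=
  Matrix.of fun i s => ∑ j, c j * C (b.repr ⁅b j, b s⁆ i)

theorem sum_repr_mul_symEmbed (g : q →ₗ[k] q) (y : q) :
    ∑ s, C (b.repr y s) * symEmbed b (g (b s)) = symEmbed b (g y) := by
  conv_rhs => rw [← b.sum_repr y]
  simp only [map_sum, map_smul, C_mul']

theorem symEmbed_eq_sum (y : q) : symEmbed b y = ∑ s, C (b.repr y s) * X s := by
  simpa [symEmbed_basis] using (sum_repr_mul_symEmbed b LinearMap.id y).symm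

theorem sum_repr_mul_bracketMatrix (y : q) (l : ι) :
    ∑ s, C (b.repr y s) * bracketMatrix b s l = symEmbed b ⁅y, b l⁆ := by
  have := sum_repr_mul_symEmbed b (-(LieAlgebra.ad k q (b l) : q →ₗ[k] q)) y
  simpa [bracketMatrix] using this

theorem symAd_symEmbed (y z : q) : symAd b y (symEmbed b z) = symEmbed b ⁅y, z⁆ := by
  have := sum_repr_mul_symEmbed b (LieAlgebra.ad k q y) z
  rw [LieAlgebra.ad_apply] at this
  rw [← this, symEmbed_eq_sum b z]
  simp [symAd, C_mul']

variable [DecidableEq ι]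

theorem symAd_eq_sum (j : ι) (g : MvPolynomial ι k) :
    symAd b (b j) g = ∑ l, bracketMatrix b j l * pderiv l g := by
  have hsum (g : MvPolynomial ι k) : (∑ l, bracketMatrix b j l • pderiv l) g =
      ∑ l, bracketMatrix b j l * pderiv l g := by
    rw [← Derivation.coeFnAddMonoidHom_apply, map_sum, Finset.sum_apply]
    rfl
  rw [← hsum]
  refine DFunLike.congr_fun (derivation_ext fun i => ?_) g
  rw [hsum]
  simp [symAd, bracketMatrix, pderiv_X, Pi.single_apply]

theorem sum_mul_symAd (c : ι → MvPolynomial ι k) (g : MvPolynomial ι k) :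
    ∑ j, c j * symAd b (b j) g = ∑ l, (c ᵥ* bracketMatrix b) l * pderiv l g := by
  simp only [symAd_eq_sum, vecMul, dotProduct, Finset.sum_mul, Finset.mul_sum, mul_assoc]
  exact Finset.sum_comm

theorem sum_mul_symEmbed_lie {c : ι → MvPolynomial ι k} {f : MvPolynomial ι k}
    (hc : c ᵥ* bracketMatrix b = f • X) (y : q) :
    ∑ j, c j * symEmbed b ⁅b j, y⁆ = f * symEmbed b y := by
  simp only [← symAd_symEmbed]
  rw [sum_mul_symAd, hc, symEmbed_eq_sum b y]
  simp [pderiv_X, Pi.single_apply, Finset.mul_sum, mul_assoc, mul_comm]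

theorem sum_repr_lie_eq_zero (htr : ∀ x : q, LinearMap.trace k q (LieAlgebra.ad k q x) = 0)
    (j : ι) : ∑ l, b.repr ⁅b j, b l⁆ l = 0 := by
  rw [← htr (b j), LinearMap.trace_eq_matrix_trace k b, Matrix.trace]
  simp [LinearMap.toMatrix_apply]

theorem trace_adMatrix (htr : ∀ x : q, LinearMap.trace k q (LieAlgebra.ad k q x) = 0)
    (c : ι → MvPolynomial ι k) : (adMatrix b c).trace = 0 := by
  simp only [Matrix.trace, adMatrix, diag_apply, of_apply]
  rw [Finset.sum_comm]
  simp [← Finset.mul_sum, ← map_sum, sum_repr_lie_eq_zero b htr]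

theorem adMatrix_transpose_mul_add {c : ι → MvPolynomial ι k} {f : MvPolynomial ι k}
    (hc : c ᵥ* bracketMatrix b = f • X) :
    (adMatrix b c)ᵀ * bracketMatrix b + bracketMatrix b * adMatrix b c =
      f • bracketMatrix b := by
  have h (p r : ι) : ((adMatrix b c)ᵀ * bracketMatrix b) p r =
      ∑ j, c j * symEmbed b ⁅⁅b j, b p⁆, b r⁆ := by
    simp only [← sum_repr_mul_bracketMatrix, mul_apply, transpose_apply, adMatrix, of_apply,
      Finset.sum_mul, Finset.mul_sum, mul_assoc]
    exact Finset.sum_comm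
  have h' : bracketMatrix b * adMatrix b c = -((adMatrix b c)ᵀ * bracketMatrix b)ᵀ := by
    rw [transpose_mul, transpose_transpose, transpose_bracketMatrix, neg_mul, neg_neg]
  ext1 p r
  rw [h', Matrix.add_apply, Matrix.neg_apply, transpose_apply, h, h, ← sub_eq_add_neg,
    ← Finset.sum_sub_distrib, Matrix.smul_apply, smul_eq_mul]
  simp only [bracketMatrix, of_apply, ← sum_mul_symEmbed_lie b hc]
  refine Finset.sum_congr rfl fun j _ => ?_
  rw [← mul_sub, ← map_sub, leibniz_lie, ← lie_skew (b p) ⁅b j, b r⁆,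
    sub_eq_add_neg]

theorem sum_symAd_eq (htr : ∀ x : q, LinearMap.trace k q (LieAlgebra.ad k q x) = 0)
    {c : ι → MvPolynomial ι k} {f : MvPolynomial ι k}
    (hc : c ᵥ* bracketMatrix b = f • X) :
    ∑ j, symAd b (b j) (c j) = ∑ l, X l * pderiv l f + Fintype.card ι * f := by
  have hdiv (j : ι) : ∑ l, pderiv l (bracketMatrix b j l) = 0 := by
    rw [← C_0, ← sum_repr_lie_eq_zero b htr j, map_sum]
    refine Finset.sum_congr rfl fun l _ => ?_
    simp only [bracketMatrix, of_apply]
    rw [symEmbed_eq_sum]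
    simp [pderiv_X, Pi.single_apply]
  have h : ∑ l, pderiv l ((c ᵥ* bracketMatrix b) l) = ∑ l, pderiv l (f * X l) := by
    rw [hc]; rfl
  simp only [vecMul, dotProduct, map_sum, Derivation.leibniz, Finset.sum_add_distrib, smul_eq_mul,
    pderiv_X_self] at h
  rw [Finset.sum_comm, Finset.sum_comm (f := fun l j => bracketMatrix b j l * _)] at h
  simp only [← Finset.mul_sum, hdiv, ← symAd_eq_sum] at h
  simpa [add_comm, mul_comm] using h

theorem adMatrix_mulVec_eq (htr : ∀ x : q, LinearMap.trace k q (LieAlgebra.ad k q x) = 0)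
    {c v : ι → MvPolynomial ι k} {f : MvPolynomial ι k} (hf : f ≠ 0)
    (hc : c ᵥ* bracketMatrix b = f • X) (hv : v ᵥ* bracketMatrix b = 0)
    (hker : ∀ u, u ᵥ* bracketMatrix b = 0 → ∀ i l, u i * v l = u l * v i) :
    adMatrix b c *ᵥ v = -(Fintype.card ι * f) • v := by
  let a : ι → ι → MvPolynomial ι k := fun j i => ∑ s, C (b.repr ⁅b j, b s⁆ i) * c s
  let u : ι → ι → MvPolynomial ι k := fun j i =>
    f * (symAd b (b j) (c i) + a j i) - symAd b (b j) f * c i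
  have ha (j l : ι) : (a j ᵥ* bracketMatrix b) l = ∑ i, c i * symEmbed b ⁅⁅b j, b i⁆, b l⁆ := by
    simp only [← sum_repr_mul_bracketMatrix, vecMul, dotProduct, a, Finset.sum_mul,
      Finset.mul_sum]
    rw [Finset.sum_comm]
    refine Finset.sum_congr rfl fun i _ => Finset.sum_congr rfl fun s _ => by ring
  have hu (j : ι) : u j ᵥ* bracketMatrix b = 0 := by
    have hcl (l : ι) : ∑ i, c i * bracketMatrix b i l = f * X l := congrFun hc l
    ext1 l
    have h1 := congrArg (symAd b (b j)) (hcl l)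
    simp only [map_sum, Derivation.leibniz, smul_eq_mul, Finset.sum_add_distrib] at h1
    have h2 : ∑ i, c i * symAd b (b j) (bracketMatrix b i l) =
        (a j ᵥ* bracketMatrix b) l + f * symAd b (b j) (X l) := by
      rw [ha, ← symEmbed_basis b, symAd_symEmbed, ← sum_mul_symEmbed_lie b hc,
        ← Finset.sum_add_distrib]
      refine Finset.sum_congr rfl fun i _ => ?_
      rw [bracketMatrix, of_apply, symAd_symEmbed, leibniz_lie, map_add, mul_add]
    have h3 : (u j ᵥ* bracketMatrix b) l =
        f * (∑ i, bracketMatrix b i l * symAd b (b j) (c i) + (a j ᵥ* bracketMatrix b) l) -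
          symAd b (b j) f * ∑ i, c i * bracketMatrix b i l := by
      simp only [vecMul, dotProduct, u, Finset.mul_sum, ← Finset.sum_add_distrib,
        ← Finset.sum_sub_distrib]
      refine Finset.sum_congr rfl fun i _ => by ring
    rw [h3, hcl, Pi.zero_apply]
    linear_combination f * h1 - f * h2
  have htru : ∑ j, u j j = f * (Fintype.card ι * f) := by
    have h1 : ∑ j, a j j = 0 := by
      simp only [a]
      rw [Finset.sum_comm]
      refine Finset.sum_eq_zero fun s _ => ?_
      rw [← Finset.sum_mul, ← map_sum]
      have := sum_repr_lie_eq_zero b htr s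
      have h' : ∑ j, b.repr ⁅b j, b s⁆ j = 0 := by
        rw [← neg_eq_zero, ← this, ← Finset.sum_neg_distrib]
        refine Finset.sum_congr rfl fun j _ => ?_
        rw [← lie_skew (b s), map_neg, Finsupp.neg_apply]
      rw [h', map_zero, zero_mul]
    have h2 : ∑ j, symAd b (b j) f * c j = f * ∑ l, X l * pderiv l f := by
      simp_rw [mul_comm _ (c _)]
      rw [sum_mul_symAd, hc]
      simp [Finset.mul_sum, mul_assoc]
    simp only [u, Finset.sum_sub_distrib, ← Finset.mul_sum, Finset.sum_add_distrib, h1, h2,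
      sum_symAd_eq b htr hc]
    ring
  ext1 l
  have h1 : ∑ j, u j l * v j = -(f * (adMatrix b c *ᵥ v) l) := by
    have e1 (g : MvPolynomial ι k) : ∑ j, v j * symAd b (b j) g = 0 := by
      simp [sum_mul_symAd, hv]
    have e2 : (adMatrix b c *ᵥ v) l = -∑ j, a j l * v j := by
      simp only [mulVec, dotProduct, adMatrix, of_apply, a, Finset.sum_mul,
        ← Finset.sum_neg_distrib]
      refine Finset.sum_congr rfl fun j _ => Finset.sum_congr rfl fun s _ => ?_
      rw [← lie_skew (b s), map_neg, Finsupp.neg_apply, map_neg]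
      ring
    have e3 : ∑ j, u j l * v j = f * (∑ j, v j * symAd b (b j) (c l) + ∑ j, a j l * v j) -
        c l * ∑ j, v j * symAd b (b j) f := by
      simp only [u, Finset.mul_sum, ← Finset.sum_add_distrib, ← Finset.sum_sub_distrib]
      refine Finset.sum_congr rfl fun i _ => by ring
    rw [e3, e1, e1, e2]
    ring
  have h2 : ∑ j, u j l * v j = f * (Fintype.card ι * f) * v l := by
    rw [← htru, Finset.sum_mul]
    exact Finset.sum_congr rfl fun j _ => hker (u j) (hu j) l j
  apply mul_left_cancel₀ hf
  rw [Pi.smul_apply, smul_eq_mul]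
  linear_combination h1 - h2

end LieLinearForm

section Contact

open MvPolynomial Matrix

variable {k q ι : Type*} [Field k] [LieRing q] [LieAlgebra k q]

theorem eval_symEmbed (b : Basis ι k q) (a : ι → k) (y : q) :
    eval a (symEmbed b y) = b.constr k a y := by
  have : (aeval a).toLinearMap ∘ₗ symEmbed b = b.constr k a :=
    b.ext fun i => by simp [symEmbed_basis]
  simpa [aeval_eq_eval] using LinearMap.congr_fun this y

theorem vecMul_map_bracketMatrix [Fintype ι] (b : Basis ι k q) (a y : ι → k) (l : ι) :
    (y ᵥ* (bracketMatrix b).map (eval a)) l = b.constr k a ⁅b.equivFun.symm y, b l⁆ := by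
  simp only [vecMul, dotProduct, bracketMatrix, map_apply, of_apply, eval_symEmbed,
    b.equivFun_symm_apply, sum_lie, smul_lie, map_sum, map_smul, smul_eq_mul]

theorem equivFun_symm_mem_coadjointStabilizer [Fintype ι] (b : Basis ι k q) (a y : ι → k) :
    b.equivFun.symm y ∈ coadjointStabilizer k (b.constr k a) ↔
      y ᵥ* (bracketMatrix b).map (eval a) = 0 := by
  simp only [_root_.funext_iff, vecMul_map_bracketMatrix]
  refine ⟨fun h l => h _, fun h z => ?_⟩
  have : (b.constr k a : q →ₗ[k] k) ∘ₗ
      (LieAlgebra.ad k q (b.equivFun.symm y) : q →ₗ[k] q) = 0 := b.ext h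
  exact LinearMap.congr_fun this z

variable [Fintype ι] [DecidableEq ι] {b : Basis ι k q}

theorem det_bracketMatrix_eq_zero [Infinite k]
    (h : ∀ β : Dual k q, 1 ≤ finrank k (coadjointStabilizer k β)) :
    (bracketMatrix b).det = 0 := by
  have := b.finiteDimensional_of_finite
  refine MvPolynomial.funext fun a => ?_
  have hpos : 0 < finrank k (coadjointStabilizer k (b.constr k a)) := h _
  obtain ⟨⟨ξ, hξ⟩, hne⟩ := finrank_pos_iff_exists_ne_zero.1 hpos
  rw [RingHom.map_det, map_zero, RingHom.mapMatrix_apply, ← exists_vecMul_eq_zero_iff]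
  refine ⟨b.equivFun ξ, by simpa using hne, ?_⟩
  rw [← equivFun_symm_mem_coadjointStabilizer, LinearEquiv.symm_apply_apply]
  exact hξ

theorem eval_det_bracketMatrix_add (φ a : ι → k) :
    eval a (bracketMatrix b + vecMulVec (C ∘ φ) (C ∘ φ)).det =
      ((bracketMatrix b).map (eval a) + vecMulVec φ φ).det := by
  rw [RingHom.map_det]
  congr 1
  ext i j
  simp [vecMulVec]

theorem exists_det_bracketMatrix_add_ne_zero
    (h : ∃ β : Dual k q, finrank k (coadjointStabilizer k β) = 1) :
    ∃ φ : ι → k, (bracketMatrix b + vecMulVec (C ∘ φ) (C ∘ φ)).det ≠ 0 := by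
  obtain ⟨β, hβ⟩ := h
  obtain ⟨⟨ξ, hξ⟩, hne, hspan⟩ := finrank_eq_one_iff'.1 hβ
  obtain ⟨φ, hφ⟩ := Projective.exists_dual_eq_one k (x := ξ) (by simpa using hne)
  refine ⟨φ ∘ b, fun h0 => ?_⟩
  have ha : b.constr k (β ∘ b) = β := b.ext fun i => by simp
  have h1 := eval_det_bracketMatrix_add (b := b) (φ ∘ b) (β ∘ b)
  rw [h0, map_zero, eq_comm, ← exists_vecMul_eq_zero_iff] at h1
  obtain ⟨y, hy, hyN⟩ := h1
  set η := b.equivFun.symm y with hη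
  have hφy : y ⬝ᵥ (φ ∘ b) = φ η := by
    simp [hη, b.equivFun_symm_apply, dotProduct]
  have hB (z : q) : β ⁅η, z⁆ + φ η * φ z = 0 := by
    have : β ∘ₗ (LieAlgebra.ad k q η : q →ₗ[k] q) + φ η • φ = 0 := b.ext fun l => by
      have := congrFun hyN l
      rw [vecMul_add, Pi.add_apply, vecMul_map_bracketMatrix, vecMul_vecMulVec, ha, hφy] at this
      exact this
    exact LinearMap.congr_fun this z
  have hφη : φ η = 0 := by
    have := hB ξ
    rwa [← lie_skew, map_neg, hξ η, hφ, neg_zero, zero_add, mul_one] at this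
  obtain ⟨t, ht⟩ := hspan ⟨η, fun z => by simpa [hφη] using hB z⟩
  have ht : t • ξ = η := congrArg Subtype.val ht
  rw [← ht, map_smul, hφ, smul_eq_mul, mul_one] at hφη
  rw [hφη, zero_smul, hη, eq_comm, LinearEquiv.map_eq_zero_iff] at ht
  exact hy ht

theorem finrank_coadjointStabilizer_le_one_s14 (φ a : ι → k)
    (h : eval a (bracketMatrix b + vecMulVec (C ∘ φ) (C ∘ φ)).det ≠ 0) :
    finrank k (coadjointStabilizer k (b.constr k a)) ≤ 1 := by
  have := b.finiteDimensional_of_finite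
  rw [eval_det_bracketMatrix_add] at h
  let ψ : coadjointStabilizer k (b.constr k a) →ₗ[k] k :=
    (b.constr k φ : q →ₗ[k] k) ∘ₗ Submodule.subtype _
  rw [← finrank_self k]
  refine LinearMap.finrank_le_finrank_of_injective (f := ψ) ?_
  rw [← LinearMap.ker_eq_bot, LinearMap.ker_eq_bot']
  rintro ⟨ξ, hξ⟩ h0
  obtain ⟨y, rfl⟩ := b.equivFun.symm.surjective ξ
  have h0 : y ⬝ᵥ φ = 0 := by
    rw [← h0]
    simp [ψ, b.equivFun_symm_apply, dotProduct]
  have hy : y = 0 := by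
    refine eq_zero_of_vecMul_eq_zero h ?_
    rw [vecMul_add, (equivFun_symm_mem_coadjointStabilizer b a y).1 hξ, vecMul_vecMulVec, h0]
    simp
  simp [hy]

theorem isContact_of_trace_ad_eq_zero [CharZero k] [FiniteDimensional k q]
    (hind : HasIndexOne k q)
    (htr : ∀ x : q, LinearMap.trace k q (LieAlgebra.ad k q x) = 0) : IsContact k q := by
  by_contra hcon
  let b := finBasis k q
  set M := bracketMatrix b
  obtain ⟨v, hv0, hv⟩ := exists_vecMul_eq_zero_iff.2 (det_bracketMatrix_eq_zero (b := b) hind.1)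
  obtain ⟨φ, hg⟩ := exists_det_bracketMatrix_add_ne_zero (b := b) hind.2
  set φ' : Fin (finrank k q) → MvPolynomial (Fin (finrank k q)) k := C ∘ φ
  set N := M + vecMulVec φ' φ' with hN
  set g := N.det with hg_def
  have hvN (u) (hu : u ᵥ* M = 0) : u ᵥ* N = (u ⬝ᵥ φ') • φ' := by
    rw [hN, vecMul_add, hu, zero_add, vecMul_vecMulVec]
  have hφv : v ⬝ᵥ φ' ≠ 0 := fun h =>
    hv0 (eq_zero_of_vecMul_eq_zero hg (by rw [hvN v hv, h, zero_smul]))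
  have hker (u) (hu : u ᵥ* M = 0) (i l) : u i * v l = u l * v i := by
    have h : (v ⬝ᵥ φ') • u - (u ⬝ᵥ φ') • v = 0 := by
      refine eq_zero_of_vecMul_eq_zero hg ?_
      rw [sub_vecMul, smul_vecMul, smul_vecMul, hvN v hv, hvN u hu, smul_comm, sub_self]
    have hi := congrFun h i
    have hl := congrFun h l
    simp only [Pi.sub_apply, Pi.smul_apply, smul_eq_mul, Pi.zero_apply] at hi hl
    apply mul_left_cancel₀ hφv
    linear_combination v l * hi - v i * hl
  have hvX : v ⬝ᵥ X = 0 := by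
    apply mul_left_cancel₀ hg
    rw [mul_zero]
    refine MvPolynomial.funext fun a => ?_
    rw [map_mul, map_zero, mul_eq_zero, or_iff_not_imp_left]
    intro ha
    have hrank := le_antisymm (finrank_coadjointStabilizer_le_one_s14 φ a ha) (hind.1 _)
    by_contra hne
    refine hcon ⟨_, hrank, b.equivFun.symm (eval a ∘ v), ?_, fun h => hne ?_⟩
    · rw [equivFun_symm_mem_coadjointStabilizer]
      ext1 l
      simpa [vecMul, dotProduct] using congrArg (eval a) (congrFun hv l)
    · rw [← h]
      simp [b.equivFun_symm_apply, dotProduct]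
  -- A solution of `c ᵥ* M = g • X`, that is, of `ad* c α = g α` at the generic point `α`.
  obtain ⟨c, hc⟩ : ∃ c, c ᵥ* M = g • X := by
    refine ⟨X ᵥ* N.adjugate, ?_⟩
    have h1 : X ᵥ* N.adjugate ᵥ* N = g • X := by
      rw [vecMul_vecMul, adjugate_mul, vecMul_smul, vecMul_one]
    have hMv : N *ᵥ v = (v ⬝ᵥ φ') • φ' := by
      have : M *ᵥ v = 0 := by
        rw [← vecMul_transpose, transpose_bracketMatrix, vecMul_neg, hv, neg_zero]
      rw [hN, add_mulVec, this, zero_add, vecMulVec_mulVec, dotProduct_comm]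
      ext; simp [mul_comm]
    have h2 : (X ᵥ* N.adjugate) ⬝ᵥ φ' = 0 := by
      apply mul_left_cancel₀ hφv
      rw [mul_zero, ← smul_eq_mul, ← dotProduct_smul, ← hMv, dotProduct_mulVec, h1,
        smul_dotProduct, dotProduct_comm, hvX, smul_zero]
    rwa [hN, vecMul_add, vecMul_vecMulVec, ← hN, h2, zero_smul, add_zero] at h1
  have hfinal := det_mul_mul_card_add_one_eq_zero (φ := φ') (transpose_bracketMatrix b) hv
    (by rwa [dotProduct_comm]) (adMatrix_transpose_mul_add b hc)
    (adMatrix_mulVec_eq b htr hg hc hv hker) (trace_adMatrix b htr c)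
  exact mul_ne_zero (mul_ne_zero hg hg) (Nat.cast_add_one_ne_zero _) hfinal

end Contact

/-- if `ind q = 1` and every element of the radical of `q` is
ad-nilpotent, then `q` is contact. -/
theorem stmt14 (k q : Type*) [Field k] [CharZero k]
    [LieRing q] [LieAlgebra k q] [FiniteDimensional k q]
    (hind : HasIndexOne k q)
    (hnil : ∀ x ∈ LieAlgebra.radical k q, IsNilpotent (LieAlgebra.ad k q x)) :
    IsContact k q :=
  isContact_of_trace_ad_eq_zero hind (trace_ad_eq_zero hnil)
end
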